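/- arXiv:1609.00303 — 3 statements merged into one kernel-verified Lean document; each statement's English description precedes it below -/
import Mathlib

section
/- Let G be a group acting by homeomorphisms on a dendrite X. If G preserves a finite nonempty subset of X, then G fixes a point of X or preserves a set of exactly two points of X. -/
open Set

/-- A dendrite: a nonempty compact connected metrizable space that is locally
connected and contains no simple closed curve. -/
def IsDendrite (X : Type*) [TopologicalSpace X] : Prop :=
  Nonempty X ∧ CompactSpace X ∧ ConnectedSpace X ∧ TopologicalSpace.MetrizableSpace X ∧
    LocallyConnectedSpace X ∧ ¬ ∃ S : Set X, Nonempty (S ≃ₜ Circle)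

/-- An action of a group on a dendrite is elementary if it fixes a point or
preserves a two-point set. -/
def ElementaryAction (G X : Type*) [Group G] [TopologicalSpace X] [MulAction G X] : Prop :=
  (∃ x : X, ∀ g : G, g • x = x) ∨
    (∃ P : Set X, P.ncard = 2 ∧ ∀ g : G, (g • ·) '' P = P)


/-- Abstract separation data: `J p x y` means that `x` and `y` lie in a connected set missing `p`. -/
structure SepData (X : Type*) (J : X → X → X → Prop) : Prop where
  irr : ∀ p x, ¬ J p p x
  refl : ∀ p x, x ≠ p → J p x x
  symm : ∀ p x y, J p x y → J p y x
  trans : ∀ p x y z, J p x y → J p y z → J p x z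
  cover : ∀ p q z, p ≠ q → J p q z ∨ J q p z
  median : ∀ x y z, x ≠ y → y ≠ z → x ≠ z → ∃ w, ¬ J w x y ∧ ¬ J w y z ∧ ¬ J w x z

section comb
variable {X : Type*} {J : X → X → X → Prop}

theorem SepData.unique (h : SepData X J) {a b c w w' : X}
    (h1 : ¬ J w a b) (h2 : ¬ J w b c) (h3 : ¬ J w a c)
    (h1' : ¬ J w' a b) (h2' : ¬ J w' b c) (h3' : ¬ J w' a c) : w = w' := by
  by_contra hne
  have key : ∀ p q x y, ¬ J p x y → ¬ (J p q x ∧ J p q y) := fun p q x y hn ⟨hx, hy⟩ =>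
    hn (h.trans _ _ _ _ (h.symm _ _ _ hx) hy)
  have ha := h.cover w w' a hne
  have hb := h.cover w w' b hne
  have hc := h.cover w w' c hne
  have k1 := key w w' _ _ h1
  have k2 := key w w' _ _ h2
  have k3 := key w w' _ _ h3
  have k1' := key w' w _ _ h1'
  have k2' := key w' w _ _ h2'
  have k3' := key w' w _ _ h3'
  tauto

/-- medians of triples of elements of `A` -/
def medSet (J : X → X → X → Prop) (A : Set X) : Set X :=
  {w | ∃ a ∈ A, ∃ b ∈ A, ∃ c ∈ A, ¬ J w a b ∧ ¬ J w b c ∧ ¬ J w a c}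

/-- closed under medians -/
def MedClosed (J : X → X → X → Prop) (V : Set X) : Prop :=
  ∀ x ∈ V, ∀ y ∈ V, ∀ z ∈ V, x ≠ y → y ≠ z → x ≠ z →
    ∃ w ∈ V, ¬ J w x y ∧ ¬ J w y z ∧ ¬ J w x z

theorem SepData.subset_medSet (h : SepData X J) (A : Set X) : A ⊆ medSet J A := fun a ha =>
  ⟨a, ha, a, ha, a, ha, h.irr _ _, h.irr _ _, h.irr _ _⟩

theorem SepData.finite_medSet (h : SepData X J) {A : Set X} (hA : A.Finite) :
    (medSet J A).Finite := by
  have : medSet J A ⊆ ⋃ a ∈ A, ⋃ b ∈ A, ⋃ c ∈ A, {w | ¬ J w a b ∧ ¬ J w b c ∧ ¬ J w a c} := by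
    rintro w ⟨a, ha, b, hb, c, hc, hw⟩
    simp only [mem_iUnion]
    exact ⟨a, ha, b, hb, c, hc, hw⟩
  refine Set.Finite.subset ?_ this
  refine hA.biUnion fun a _ => hA.biUnion fun b _ => hA.biUnion fun c _ => ?_
  refine Set.Subsingleton.finite ?_
  rintro w ⟨h1, h2, h3⟩ w' ⟨h1', h2', h3'⟩
  exact h.unique h1 h2 h3 h1' h2' h3'

theorem SepData.medSet_reach (h : SepData X J) {A : Set X} {x w : X} (hx : x ∈ medSet J A)
    (hne : x ≠ w) : ∃ a ∈ A, J w x a := by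
  obtain ⟨a, ha, b, hb, c, hc, h1, h2, h3⟩ := hx
  rcases h.cover x w a hne with h4 | h4
  · rcases h.cover x w b hne with h5 | h5
    · exact absurd (h.trans _ _ _ _ (h.symm _ _ _ h4) h5) h1
    · exact ⟨b, hb, h5⟩
  · exact ⟨a, ha, h4⟩

theorem SepData.medClosed_medSet (h : SepData X J) (A : Set X) : MedClosed J (medSet J A) := by
  intro x hx y hy z hz hxy hyz hxz
  obtain ⟨w, h1, h2, h3⟩ := h.median x y z hxy hyz hxz
  refine ⟨w, ?_, h1, h2, h3⟩
  by_cases ex : x = w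
  · exact ex ▸ hx
  by_cases ey : y = w
  · exact ey ▸ hy
  by_cases ez : z = w
  · exact ez ▸ hz
  obtain ⟨a, ha, ja⟩ := h.medSet_reach hx ex
  obtain ⟨b, hb, jb⟩ := h.medSet_reach hy ey
  obtain ⟨c, hc, jc⟩ := h.medSet_reach hz ez
  have key : ∀ {p q r s}, J w p r → J w q s → ¬ J w p q → ¬ J w r s := fun hp hq hn hr =>
    hn (h.trans _ _ _ _ (h.trans _ _ _ _ hp hr) (h.symm _ _ _ hq))
  exact ⟨a, ha, b, hb, c, hc, key ja jb h1, key jb jc h2, key ja jc h3⟩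

/-- non-extremal points -/
def innerPts (J : X → X → X → Prop) (V : Set X) : Set X :=
  {v | v ∈ V ∧ ∃ x ∈ V, ∃ y ∈ V, x ≠ v ∧ y ≠ v ∧ ¬ J v x y}

theorem MedClosed.inner {V : Set X} (hV : MedClosed J V) : MedClosed J (innerPts J V) := by
  intro x hx y hy z hz hxy hyz hxz
  obtain ⟨w, hw, h1, h2, h3⟩ := hV x hx.1 y hy.1 z hz.1 hxy hyz hxz
  refine ⟨w, ?_, h1, h2, h3⟩
  by_cases ex : x = w
  · exact ex ▸ hx
  by_cases ey : y = w
  · exact ey ▸ hy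
  exact ⟨hw, x, hx.1, y, hy.1, ex, ey, h1⟩

theorem MedClosed.inner_nonempty {V : Set X} (hV : MedClosed J V) (hc : 2 < V.ncard) :
    (innerPts J V).Nonempty := by
  obtain ⟨x, hx, y, hy, z, hz, hxy, hxz, hyz⟩ :=
    (Set.two_lt_ncard_iff (Set.finite_of_ncard_pos (by omega))).1 hc |>
      fun ⟨a, b, c, ha, hb, hc, h1, h2, h3⟩ => (⟨a, ha, b, hb, c, hc, h1, h2, h3⟩ :
        ∃ x ∈ V, ∃ y ∈ V, ∃ z ∈ V, x ≠ y ∧ x ≠ z ∧ y ≠ z)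
  obtain ⟨w, hw, h1, h2, h3⟩ := hV x hx y hy z hz hxy hyz hxz
  refine ⟨w, hw, ?_⟩
  by_cases ex : x = w
  · subst ex
    exact ⟨y, hy, z, hz, hxy.symm, hxz.symm, h2⟩
  by_cases ey : y = w
  · subst ey
    exact ⟨x, hx, z, hz, hxy, hyz.symm, h3⟩
  exact ⟨x, hx, y, hy, ex, ey, h1⟩

theorem SepData.exists_extremal (h : SepData X J) {V : Set X} (hf : V.Finite)
    (n : ℕ) : ∀ v ∈ V, ∀ u ∈ V, u ≠ v → {t ∈ V | J v u t}.ncard ≤ n →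
    ∃ e ∈ V, e ∉ innerPts J V := by
  induction n with
  | zero =>
    intro v hv u hu huv hn
    have : {t ∈ V | J v u t} = ∅ := by
      rw [← Set.ncard_eq_zero (hf.subset (sep_subset _ _))]; omega
    have h2 : u ∈ {t ∈ V | J v u t} := ⟨hu, h.refl _ _ huv⟩
    rw [this] at h2
    exact absurd h2 (by simp)
  | succ n ih =>
    intro v hv u hu huv hn
    by_cases hi : u ∈ innerPts J V
    · obtain ⟨_, x, hx, y, hy, hxu, hyu, hxy⟩ := hi
      have : ∃ x ∈ V, x ≠ u ∧ ¬ J u v x := by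
        by_contra! hcon
        exact hxy (h.trans _ _ _ _ (h.symm _ _ _ (hcon x hx hxu)) (hcon y hy hyu))
      obtain ⟨x, hx, hxu, hvx⟩ := this
      refine ih u hu x hx hxu ?_
      have hlt : {t ∈ V | J u x t}.ncard < {t ∈ V | J v u t}.ncard := by
        refine Set.ncard_lt_ncard ?_ (hf.subset (sep_subset _ _))
        refine (ssubset_iff_of_subset ?_).2 ⟨u, ⟨hu, h.refl _ _ huv⟩, ?_⟩
        · rintro t ⟨ht, hj⟩
          refine ⟨ht, ?_⟩
          rcases h.cover u v t huv with h1 | h1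
          · exact absurd (h.trans _ _ _ _ h1 (h.symm _ _ _ hj)) hvx
          · exact h1
        · rintro ⟨_, hj⟩
          exact h.irr _ _ (h.symm _ _ _ hj)
      omega
    · exact ⟨u, hu, hi⟩

theorem comb_main {G : Type*} [Group G] [TopologicalSpace X] [MulAction G X] (h : SepData X J)
    (heq : ∀ (g : G) p x y, J p x y → J (g • p) (g • x) (g • y)) :
    ∀ (n : ℕ) (V : Set X), V.ncard = n → V.Finite → V.Nonempty → MedClosed J V →
    (∀ (g : G), ∀ v ∈ V, g • v ∈ V) → ElementaryAction G X := by
  intro n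
  induction n using Nat.strong_induction_on with
  | _ n ih =>
  intro V hn hf hne hm hinv
  have heq' : ∀ (g : G) p x y, ¬ J p x y → ¬ J (g • p) (g • x) (g • y) := by
    intro g p x y hj hj'
    have := heq g⁻¹ _ _ _ hj'
    simp only [inv_smul_smul] at this
    exact hj this
  by_cases h2 : 2 < V.ncard
  · obtain ⟨v, hv, u, hu, hvu⟩ := (Set.one_lt_ncard hf).1 (by omega : 1 < V.ncard)
    obtain ⟨e, he, hei⟩ := h.exists_extremal hf _ v hv u hu hvu.symm le_rfl
    have hss : innerPts J V ⊂ V := (ssubset_iff_of_subset fun x hx => hx.1).2 ⟨e, he, hei⟩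
    refine ih (innerPts J V).ncard ?_ (innerPts J V) rfl (hf.subset hss.1)
      (hm.inner_nonempty h2) hm.inner ?_
    · rw [← hn]; exact Set.ncard_lt_ncard hss hf
    · rintro g v ⟨hv, x, hx, y, hy, hxv, hyv, hj⟩
      refine ⟨hinv g v hv, g • x, hinv g x hx, g • y, hinv g y hy, ?_, ?_, heq' g _ _ _ hj⟩
      · simpa using hxv
      · simpa using hyv
  · have hpos := (Set.ncard_pos hf).2 hne
    have : V.ncard = 1 ∨ V.ncard = 2 := by omega
    rcases this with h1 | h1
    · obtain ⟨x, rfl⟩ := Set.ncard_eq_one.1 h1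
      exact Or.inl ⟨x, fun g => by simpa using hinv g x⟩
    · refine Or.inr ⟨V, h1, fun g => ?_⟩
      apply Subset.antisymm
      · rintro _ ⟨v, hv, rfl⟩
        exact hinv g v hv
      · intro v hv
        exact ⟨g⁻¹ • v, hinv g⁻¹ v hv, by simp⟩

end comb

section paths

theorem dep_choice {S : Type*} (P : ℕ → S → Prop) (Q : ℕ → S → S → Prop) (s0 : S) (h0 : P 0 s0)
    (h : ∀ n s, P n s → ∃ s', P (n + 1) s' ∧ Q n s s') :
    ∃ u : ℕ → S, ∀ n, P n (u n) ∧ Q n (u n) (u (n + 1)) := by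
  have : Nonempty S := ⟨s0⟩
  choose! f hf using h
  let u : ℕ → S := fun n => Nat.rec s0 (fun n s => f n s) n
  have hP : ∀ n, P n (u n) := by
    intro n
    induction n with
    | zero => exact h0
    | succ n ih => exact (hf n _ ih).1
  exact ⟨u, fun n => ⟨hP n, (hf n _ (hP n)).2⟩⟩

variable {X : Type*} [MetricSpace X]

/-- two points in a common small connected open set -/
def SmallConn (ε : ℝ) (a b : X) : Prop :=
  ∃ W : Set X, IsOpen W ∧ IsPreconnected W ∧ a ∈ W ∧ b ∈ W ∧ ∀ u ∈ W, ∀ v ∈ W, dist u v < ε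

theorem SmallConn.dist_lt {ε : ℝ} {a b : X} (h : SmallConn ε a b) : dist a b < ε := by
  obtain ⟨W, _, _, ha, hb, hW⟩ := h
  exact hW a ha b hb

theorem exists_small_nhd [LocallyConnectedSpace X] {V : Set X} (hV : IsOpen V) {b : X} (hb : b ∈ V)
    {ε : ℝ} (hε : 0 < ε) : ∃ W ⊆ V, IsOpen W ∧ IsPreconnected W ∧ b ∈ W ∧
      ∀ u ∈ W, ∀ v ∈ W, dist u v < ε := by
  obtain ⟨W, hW, hWo, hbW, hWc⟩ := locallyConnectedSpace_iff_subsets_isOpen_isConnected.1 ‹_› b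
    (V ∩ Metric.ball b (ε / 2)) (Filter.inter_mem (hV.mem_nhds hb)
      (Metric.ball_mem_nhds b (by positivity)))
  refine ⟨W, fun x hx => (hW hx).1, hWo, hWc.isPreconnected, hbW, fun u hu v hv => ?_⟩
  have h1 : dist u b < ε / 2 := (hW hu).2
  have h2 : dist v b < ε / 2 := (hW hv).2
  have := dist_triangle_right u v b
  linarith

theorem SmallConn.refl [LocallyConnectedSpace X] {ε : ℝ} (hε : 0 < ε) (a : X) :
    SmallConn ε a a := by
  obtain ⟨W, _, h1, h2, h3, h4⟩ := exists_small_nhd isOpen_univ (mem_univ a) hε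
  exact ⟨W, h1, h2, h3, h3, h4⟩

theorem chain_rel [LocallyConnectedSpace X] {V : Set X} (hV : IsOpen V) (hc : IsPreconnected V)
    {x y : X} (hx : x ∈ V) (hy : y ∈ V) {ε : ℝ} (hε : 0 < ε) :
    Relation.ReflTransGen (fun a b => SmallConn ε a b ∧ b ∈ V) x y := by
  set r := fun a b : X => SmallConn ε a b ∧ b ∈ V with hr
  let S : Set X := {z | z ∈ V ∧ Relation.ReflTransGen r x z}
  have hS : IsOpen S := by
    rw [isOpen_iff_mem_nhds]
    rintro b ⟨hb, hxb⟩
    obtain ⟨W, hWV, hWo, hWc, hbW, hd⟩ := exists_small_nhd hV hb hε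
    refine Filter.mem_of_superset (hWo.mem_nhds hbW) fun z hz => ⟨hWV hz, hxb.tail ?_⟩
    exact ⟨⟨W, hWo, hWc, hbW, hz, hd⟩, hWV hz⟩
  have : V ⊆ S := by
    refine hc.subset_of_closure_inter_subset hS ⟨x, hx, hx, .refl⟩ ?_
    rintro b ⟨hb, hbV⟩
    obtain ⟨W, hWV, hWo, hWc, hbW, hd⟩ := exists_small_nhd hV hbV hε
    obtain ⟨c, hcW, hcV, hxc⟩ := mem_closure_iff.1 hb W hWo hbW
    exact ⟨hbV, hxc.tail ⟨⟨W, hWo, hWc, hcW, hbW, hd⟩, hbV⟩⟩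
  exact (this hy).2

theorem chain_fun [LocallyConnectedSpace X] {V : Set X} (hV : IsOpen V) (hc : IsPreconnected V)
    {x y : X} (hx : x ∈ V) (hy : y ∈ V) {ε : ℝ} (hε : 0 < ε) :
    ∃ (n : ℕ) (f : ℕ → X), f 0 = x ∧ (∀ i, n ≤ i → f i = y) ∧
      ∀ i, SmallConn ε (f i) (f (i + 1)) ∧ f i ∈ V := by
  have h := chain_rel hV hc hx hy hε
  induction h with
  | refl => exact ⟨0, fun _ => x, rfl, fun _ _ => rfl, fun _ => ⟨.refl hε _, hx⟩⟩
  | @tail b c hab hbc ih =>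
    by_cases hb : b ∈ V
    · obtain ⟨n, f, h0, hn, hf⟩ := ih hb
      refine ⟨n + 1, fun i => if i ≤ n then f i else c, by simp [h0], fun i hi => ?_, fun i => ?_⟩
      · exact if_neg (by omega)
      · rcases lt_trichotomy i n with h | h | h
        · simp only [if_pos (show i ≤ n by omega), if_pos (show i + 1 ≤ n by omega)]
          exact hf i
        · subst h
          simp only [if_pos le_rfl, if_neg (show ¬ i + 1 ≤ i by omega)]
          rw [hn i le_rfl]
          exact ⟨hbc.1, hb⟩
        · simp only [if_neg (show ¬ i ≤ n by omega), if_neg (show ¬ i + 1 ≤ n by omega)]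
          exact ⟨.refl hε _, hy⟩
    · exfalso
      rcases Relation.ReflTransGen.cases_tail hab with h | ⟨d, _, h⟩
      · exact hb (h ▸ hx)
      · exact hb h.2

/-- a stage of the path construction -/
def StageP (x y : X) (ε : ℝ) (s : (ℕ → X) × ℕ) : Prop :=
  s.1 0 = x ∧ (∀ i, s.2 ≤ i → s.1 i = y) ∧ (∀ i, SmallConn ε (s.1 i) (s.1 (i + 1))) ∧ 0 < s.2

theorem stage_step [LocallyConnectedSpace X] {x y : X} {ε δ : ℝ} (hε : 0 < ε) (hδ : 0 < δ)
    (s : (ℕ → X) × ℕ) (hs : StageP x y ε s) :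
    ∃ s' : (ℕ → X) × ℕ, StageP x y δ s' ∧
      ∃ M : ℕ, 0 < M ∧ s'.2 = s.2 * M ∧ ∀ k, dist (s.1 (k / M)) (s'.1 k) < ε := by
  obtain ⟨c, L⟩ := s
  obtain ⟨h0, hL, hc, hpos⟩ := hs
  simp only at h0 hL hc hpos
  have key : ∀ i, ∃ (n : ℕ) (f : ℕ → X), f 0 = c i ∧ (∀ j, n ≤ j → f j = c (i + 1)) ∧
      (∀ j, SmallConn δ (f j) (f (j + 1)) ∧ dist (c i) (f j) < ε) ∧ (L ≤ i → n = 0) := by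
    intro i
    by_cases hi : L ≤ i
    · refine ⟨0, fun _ => y, (hL i hi).symm, fun j _ => (hL _ (by omega)).symm, fun j => ⟨.refl hδ _, ?_⟩,
        fun _ => rfl⟩
      rw [hL i hi, dist_self]; exact hε
    · obtain ⟨V, hVo, hVc, ha, hb, hd⟩ := hc i
      obtain ⟨n, f, hf0, hfn, hf⟩ := chain_fun hVo hVc ha hb hδ
      exact ⟨n, f, hf0, hfn, fun j => ⟨(hf j).1, hd _ ha _ (hf j).2⟩, fun h => absurd h hi⟩
  choose n f hf0 hfn hf hn using key
  set M := 1 + ∑ i ∈ Finset.range L, n i with hM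
  have hMpos : 0 < M := by omega
  have hnM : ∀ i, n i ≤ M := by
    intro i
    by_cases hi : L ≤ i
    · rw [hn i hi]; omega
    · have := Finset.single_le_sum (f := n) (fun _ _ => Nat.zero_le _)
        (Finset.mem_range.2 (by omega : i < L))
      omega
  refine ⟨(fun k => f (k / M) (k % M), L * M), ⟨?_, ?_, ?_, ?_⟩, M, hMpos, rfl, fun k => (hf _ _).2⟩
  · simp [hf0, h0]
  · intro k hk
    have hk' : L ≤ k / M := (Nat.le_div_iff_mul_le hMpos).2 hk
    simp only
    rw [hfn _ _ (by rw [hn _ hk']; omega)]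
    exact hL _ (by omega)
  · intro k
    simp only
    have hmod := Nat.mod_lt k hMpos
    have hdm := Nat.div_add_mod k M
    by_cases h : k % M + 1 < M
    · have h1 : (k + 1) / M = k / M := by
        rw [Nat.div_eq_iff hMpos] 
        constructor
        · rw [mul_comm]; omega
        · have : k / M * M = M * (k / M) := mul_comm _ _
          omega
      have h2 : (k + 1) % M = k % M + 1 := by
        have := Nat.div_add_mod (k + 1) M
        rw [h1] at this
        omega
      rw [h1, h2]
      exact (hf _ _).1
    · have h3 : k + 1 = M * (k / M + 1) := by rw [mul_add]; omega
      have h1 : (k + 1) / M = k / M + 1 := by rw [h3]; exact Nat.mul_div_cancel_left _ hMpos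
      have h2 : (k + 1) % M = 0 := by rw [h3]; exact Nat.mul_mod_right _ _
      rw [h1, h2, hf0]
      have h4 := (hf (k / M) (k % M)).1
      rwa [hfn (k / M) (k % M + 1) (by have := hnM (k / M); omega)] at h4
  · positivity

theorem floor_close {a b : ℝ} (h1 : a ≤ b) (h2 : b ≤ a + 1) :
    ⌊b⌋₊ = ⌊a⌋₊ ∨ ⌊b⌋₊ = ⌊a⌋₊ + 1 := by
  have h3 := Nat.floor_mono h1
  have h4 : ⌊b⌋₊ < ⌊a⌋₊ + 2 := by
    rw [Nat.floor_lt' (by omega)]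
    have := Nat.lt_floor_add_one a
    push_cast
    linarith
  omega

theorem exists_path [CompleteSpace X] [LocallyConnectedSpace X] [PreconnectedSpace X] (x y : X) :
    ∃ F : ℝ → X, Continuous F ∧ F 0 = x ∧ F 1 = y := by
  have hpow : ∀ n : ℕ, (0 : ℝ) < (1 / 2) ^ n := fun n => by positivity
  have h0 : ∃ s : (ℕ → X) × ℕ, StageP x y ((1 / 2) ^ 0) s := by
    obtain ⟨n, f, h0, hn, hf⟩ := chain_fun isOpen_univ isPreconnected_univ (mem_univ x) (mem_univ y)
      (hpow 0)
    exact ⟨(f, n + 1), h0, fun i hi => hn i (by simp at hi; omega), fun i => (hf i).1, by simp⟩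
  obtain ⟨s0, hs0⟩ := h0
  obtain ⟨u, hu⟩ := dep_choice (fun n s => StageP x y ((1 / 2) ^ n) s)
    (fun n s s' => ∃ M : ℕ, 0 < M ∧ s'.2 = s.2 * M ∧
      ∀ k, dist (s.1 (k / M)) (s'.1 k) < (1 / 2) ^ n) s0 hs0
    (fun n s hs => stage_step (hpow n) (hpow (n + 1)) s hs)
  let f : ℕ → ℝ → X := fun n t => (u n).1 ⌊t * (u n).2⌋₊
  have hdist : ∀ t n, dist (f n t) (f (n + 1) t) ≤ 1 * (1 / 2) ^ n := by
    intro t n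
    obtain ⟨_, M, hM, hL, hd⟩ := hu n
    have := hd ⌊t * (u (n + 1)).2⌋₊
    rw [← Nat.floor_div_natCast, hL] at this
    have e : t * ((u n).2 * M : ℕ) / (M : ℝ) = t * (u n).2 := by
      push_cast; field_simp
    rw [e] at this
    simp only [f, one_mul]
    rw [hL]
    exact this.le
  have hlim : ∀ t, ∃ z, Filter.Tendsto (fun n => f n t) Filter.atTop (nhds z) := fun t =>
    cauchySeq_tendsto_of_complete (cauchySeq_of_le_geometric (1 / 2) 1 (by norm_num) (hdist t))
  choose F hF using hlim
  have hFd : ∀ t n, dist (f n t) (F t) ≤ 2 * (1 / 2) ^ n := by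
    intro t n
    have := dist_le_of_le_geometric_of_tendsto (1 / 2) 1 (by norm_num) (hdist t) (hF t) n
    norm_num at this ⊢
    linarith
  have hjump : ∀ (n : ℕ) (s t : ℝ), s ≤ t → t - s ≤ 1 / (u n).2 → dist (f n s) (f n t) ≤ (1 / 2) ^ n := by
    intro n s t hst hts
    obtain ⟨⟨_, _, hc, hp⟩, _⟩ := hu n
    have hp' : (0 : ℝ) < (u n).2 := by exact_mod_cast hp
    rw [le_div_iff₀ hp'] at hts
    simp only [f]
    rcases floor_close (a := s * (u n).2) (b := t * (u n).2)
      (mul_le_mul_of_nonneg_right hst hp'.le) (by linarith) with h | h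
    · rw [h, dist_self]; positivity
    · rw [h]; exact (hc _).dist_lt.le
  refine ⟨F, ?_, ?_, ?_⟩
  · rw [Metric.continuous_iff]
    intro t ε hε
    obtain ⟨n, hn⟩ := exists_pow_lt_of_lt_one (show 0 < ε / 5 by positivity)
      (show (1 / 2 : ℝ) < 1 by norm_num)
    have hp : (0 : ℝ) < (u n).2 := by exact_mod_cast (hu n).1.2.2.2
    refine ⟨1 / (u n).2, by positivity, fun s hs => ?_⟩
    have h1 : dist (f n s) (f n t) ≤ (1 / 2) ^ n := by
      rw [Real.dist_eq, abs_lt] at hs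
      rcases le_total s t with h | h
      · exact hjump n s t h (by linarith)
      · rw [dist_comm]; exact hjump n t s h (by linarith)
    have h2 := hFd s n
    have h3 := hFd t n
    have h4 := dist_triangle4 (F s) (f n s) (f n t) (F t)
    rw [dist_comm (F s) (f n s)] at h4
    linarith
  · refine tendsto_nhds_unique (hF 0) ?_
    have : ∀ n, f n 0 = x := fun n => by simp [f, (hu n).1.1]
    simp [this]
  · refine tendsto_nhds_unique (hF 1) ?_
    have : ∀ n, f n 1 = y := fun n => by
      simp only [f, one_mul, Nat.floor_natCast]
      exact (hu n).1.2.1 _ le_rfl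
    simp [this]

end paths

section arcs
variable {X : Type*} [MetricSpace X]

/-- closed sets of parameters whose gaps are closed loops -/
def LoopFree (F : ℝ → X) (K : Set ℝ) : Prop :=
  IsClosed K ∧ K ⊆ Icc 0 1 ∧ (0 : ℝ) ∈ K ∧ (1 : ℝ) ∈ K ∧
    ∀ a ∈ K, ∀ b ∈ K, a < b → (∀ z ∈ K, a < z → z < b → False) → F a = F b

theorem exists_greatest_le {K : Set ℝ} (hK : IsClosed K) {l t : ℝ} (hl : l ∈ K) (hlt : l ≤ t) :
    ∃ p ∈ K, l ≤ p ∧ p ≤ t ∧ ∀ k ∈ K, k ≤ t → k ≤ p := by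
  have hc : IsCompact (K ∩ Icc l t) := isCompact_Icc.inter_left hK
  obtain ⟨p, ⟨hpK, hp⟩, hmax⟩ := hc.exists_isGreatest ⟨l, hl, le_rfl, hlt⟩
  refine ⟨p, hpK, hp.1, hp.2, fun k hk hkt => ?_⟩
  rcases le_total l k with h | h
  · exact hmax ⟨hk, h, hkt⟩
  · exact h.trans hp.1

theorem exists_least_ge {K : Set ℝ} (hK : IsClosed K) {l t : ℝ} (hl : l ∈ K) (hlt : t ≤ l) :
    ∃ p ∈ K, p ≤ l ∧ t ≤ p ∧ ∀ k ∈ K, t ≤ k → p ≤ k := by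
  have hc : IsCompact (K ∩ Icc t l) := isCompact_Icc.inter_left hK
  obtain ⟨p, ⟨hpK, hp⟩, hmax⟩ := hc.exists_isLeast ⟨l, hl, hlt, le_rfl⟩
  refine ⟨p, hpK, hp.2, hp.1, fun k hk hkt => ?_⟩
  rcases le_total k l with h | h
  · exact hmax ⟨hk, hkt, h⟩
  · exact hp.2.trans h

theorem loopFree_sInter {F : ℝ → X} (hF : Continuous F) {c : Set (Set ℝ)}
    (hc : ∀ K ∈ c, LoopFree F K) (hch : IsChain (· ⊆ ·) c) (hne : c.Nonempty) :
    LoopFree F (⋂₀ c) := by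
  obtain ⟨K0, hK0⟩ := hne
  refine ⟨isClosed_sInter fun K hK => (hc K hK).1, fun x hx => (hc K0 hK0).2.1 (hx K0 hK0),
    fun K hK => (hc K hK).2.2.1, fun K hK => (hc K hK).2.2.2.1, ?_⟩
  intro a ha b hb hab hgap
  by_contra hne
  have hd : 0 < dist (F a) (F b) / 2 := half_pos (dist_pos.2 hne)
  obtain ⟨δ1, hδ1, h1⟩ := Metric.continuous_iff.1 hF a _ hd
  obtain ⟨δ2, hδ2, h2⟩ := Metric.continuous_iff.1 hF b _ hd
  obtain ⟨η, hη, hη1⟩ := exists_between (show 0 < min (min δ1 δ2) ((b - a) / 2) by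
    refine lt_min (lt_min hδ1 hδ2) (by linarith))
  have e1 : η < δ1 := hη1.trans_le ((min_le_left _ _).trans (min_le_left _ _))
  have e2 : η < δ2 := hη1.trans_le ((min_le_left _ _).trans (min_le_right _ _))
  have e3 : η < (b - a) / 2 := hη1.trans_le (min_le_right _ _)
  have hex : ∃ K ∈ c, ∀ z ∈ K, a + η ≤ z → z ≤ b - η → False := by
    by_contra! hcon
    have : Nonempty c := ⟨⟨K0, hK0⟩⟩
    have := IsCompact.nonempty_iInter_of_directed_nonempty_isCompact_isClosed
      (fun K : c => (K : Set ℝ) ∩ Icc (a + η) (b - η)) ?_ ?_ ?_ ?_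
    · obtain ⟨z, hz⟩ := this
      rw [mem_iInter] at hz
      have hz' := (hz ⟨K0, hK0⟩).2
      exact hgap z (fun K hK => (hz ⟨K, hK⟩).1) (by linarith [hz'.1]) (by linarith [hz'.2])
    · rintro ⟨K, hK⟩ ⟨L, hL⟩
      rcases hch.total hK hL with h | h
      · exact ⟨⟨K, hK⟩, Subset.rfl, inter_subset_inter_left _ h⟩
      · exact ⟨⟨L, hL⟩, inter_subset_inter_left _ h, Subset.rfl⟩
    · rintro ⟨K, hK⟩
      obtain ⟨z, hz, hz1, hz2, _⟩ := hcon K hK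
      exact ⟨z, hz, hz1, hz2⟩
    · rintro ⟨K, hK⟩
      exact isCompact_Icc.inter_left (hc K hK).1
    · rintro ⟨K, hK⟩
      exact (hc K hK).1.inter isClosed_Icc
  obtain ⟨K, hK, hKd⟩ := hex
  obtain ⟨hKc, -, -, -, hKg⟩ := hc K hK
  obtain ⟨a', ha', haa', ha'e, hamax⟩ := exists_greatest_le hKc (ha K hK)
    (show a ≤ a + η by linarith)
  obtain ⟨b', hb', hbb', hb'e, hbmax⟩ := exists_least_ge hKc (hb K hK)
    (show b - η ≤ b by linarith)
  have hF' : F a' = F b' := by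
    refine hKg a' ha' b' hb' (by linarith) fun z hz hz1 hz2 => ?_
    rcases le_total z (a + η) with h | h
    · linarith [hamax z hz h]
    · rcases le_total z (b - η) with h' | h'
      · exact hKd z hz h h'
      · linarith [hbmax z hz h']
  have k1 := h1 a' (by rw [Real.dist_eq, abs_lt]; constructor <;> linarith)
  have k2 := h2 b' (by rw [Real.dist_eq, abs_lt]; constructor <;> linarith)
  rw [hF'] at k1
  have := dist_triangle_left (F a) (F b) (F b')
  linarith

theorem exists_min_loopFree {F : ℝ → X} (hF : Continuous F) :
    ∃ K, LoopFree F K ∧ ∀ s ∈ K, ∀ t ∈ K, s < t → F s = F t → ∀ z ∈ K, s < z → z < t → False := by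
  obtain ⟨K, -, hK⟩ := zorn_superset_nonempty {K | LoopFree F K}
    (fun c hc hch hne => ⟨⋂₀ c, loopFree_sInter hF hc hch hne, fun s hs => sInter_subset_of_mem hs⟩)
    (Icc 0 1) ⟨isClosed_Icc, Subset.rfl, by simp, by simp, fun a ha b hb hab h =>
      (h ((a + b) / 2) ⟨by linarith [ha.1, hb.1], by linarith [ha.2, hb.2]⟩
        (by linarith) (by linarith)).elim⟩
  have hK1 : LoopFree F K := hK.prop
  refine ⟨K, hK1, fun s hs t ht hst hFst z hz hsz hzt => ?_⟩
  obtain ⟨h1, h2, h3, h4, h5⟩ := hK1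
  have hK' : LoopFree F (K \ Ioo s t) := by
    refine ⟨h1.sdiff isOpen_Ioo, sdiff_subset.trans h2, ⟨h3, fun h => ?_⟩, ⟨h4, fun h => ?_⟩, ?_⟩
    · linarith [h.1, (h2 hs).1]
    · linarith [h.2, (h2 ht).2]
    · rintro a ⟨haK, ha⟩ b ⟨hbK, hb⟩ hab hgap
      by_cases hh : ∀ z ∈ K, a < z → z < b → False
      · exact h5 a haK b hbK hab hh
      · push Not at hh
        obtain ⟨w, hw, haw, hwb, _⟩ := hh
        have hwst : w ∈ Ioo s t := by
          by_contra hn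
          exact hgap w ⟨hw, hn⟩ haw hwb
        have has : a ≤ s := by
          by_contra! hn
          exact ha ⟨hn, haw.trans hwst.2⟩
        have hbt : t ≤ b := by
          by_contra! hn
          exact hb ⟨hwst.1.trans hwb, hn⟩
        have e1 : a = s := by
          by_contra hn
          exact hgap s ⟨hs, fun h => lt_irrefl _ h.1⟩ (lt_of_le_of_ne has hn) (hwst.1.trans hwb)
        have e2 : t = b := by
          by_contra hn
          exact hgap t ⟨ht, fun h => lt_irrefl _ h.2⟩ (haw.trans hwst.2) (lt_of_le_of_ne hbt hn)
        rw [e1, ← e2]; exact hFst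
  exact (hK.le_of_le hK' sdiff_subset hz).2 ⟨hsz, hzt⟩

theorem exists_monotone_path {F : ℝ → X} (hF : Continuous F) :
    ∃ G : ℝ → X, Continuous G ∧ G 0 = F 0 ∧ G 1 = F 1 ∧
      ∀ s r t, s ≤ r → r ≤ t → G s = G t → G r = G s := by
  obtain ⟨K, ⟨h1, h2, h3, h4, h5⟩, h6⟩ := exists_min_loopFree hF
  have hp : ∀ t : ℝ, ∃ p ∈ K, 0 ≤ p ∧ p ≤ max t 0 ∧ ∀ k ∈ K, k ≤ max t 0 → k ≤ p := fun t =>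
    exists_greatest_le h1 h3 (le_max_right _ _)
  choose π hπK hπ0 hπle hπmax using hp
  have hmono : ∀ s t, s ≤ t → π s ≤ π t := fun s t hst =>
    hπmax t _ (hπK s) ((hπle s).trans (max_le_max hst le_rfl))
  refine ⟨fun t => F (π t), ?_, ?_, ?_, ?_⟩
  · have huc := isCompact_Icc.uniformContinuousOn_of_continuous
      (hF.continuousOn (s := Icc (0 : ℝ) 1))
    rw [Metric.uniformContinuousOn_iff] at huc
    rw [Metric.continuous_iff]
    intro t ε hε
    obtain ⟨δ, hδ, hd⟩ := huc ε hε
    have key : ∀ s t, s ≤ t → t - s < δ → dist (F (π s)) (F (π t)) < ε := by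
      intro s t hst hts
      have hst' : max t 0 - max s 0 < δ := by
        rcases le_total 0 s with h | h
        · rw [max_eq_left h, max_eq_left (h.trans hst)]; exact hts
        · rw [max_eq_right h]
          rcases le_total 0 t with h' | h'
          · rw [max_eq_left h']; linarith
          · rw [max_eq_right h']; linarith
      by_cases hle : π t ≤ max s 0
      · have : π s = π t := le_antisymm (hmono s t hst) (hπmax s _ (hπK t) hle)
        rw [this, dist_self]; exact hε
      · push Not at hle
        obtain ⟨b, hb, hbt, hsb, hbmin⟩ := exists_least_ge h1 (hπK t) hle.le
        have hFb : F (π s) = F b := by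
          rcases eq_or_lt_of_le ((hπle s).trans hsb) with h | h
          · rw [h]
          · refine h5 _ (hπK s) _ hb h fun z hz hz1 hz2 => ?_
            rcases le_total z (max s 0) with h' | h'
            · linarith [hπmax s z hz h']
            · linarith [hbmin z hz h']
        rw [hFb]
        refine hd b (h2 hb) _ (h2 (hπK t)) ?_
        rw [Real.dist_eq, abs_lt]
        have := hπle t
        constructor <;> linarith
    refine ⟨δ, hδ, fun s hs => ?_⟩
    rw [Real.dist_eq, abs_lt] at hs
    rcases le_total s t with h | h
    · exact key s t h (by linarith)
    · rw [dist_comm]; exact key t s h (by linarith)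
  · have : π 0 = 0 := le_antisymm (by simpa using hπle 0) (hπ0 0)
    simp [this]
  · have : π 1 = 1 := le_antisymm (h2 (hπK 1)).2 (hπmax 1 1 h4 (by simp))
    simp [this]
  · intro s r t hsr hrt hst
    simp only at hst ⊢
    have m1 := hmono s r hsr
    have m2 := hmono r t hrt
    rcases eq_or_lt_of_le m1 with h | h
    · rw [h]
    rcases eq_or_lt_of_le m2 with h' | h'
    · rw [h', hst]
    exact (h6 _ (hπK s) _ (hπK t) (h.trans h') hst _ (hπK r) h h').elim

end arcs

section reparam
variable {X : Type*} [MetricSpace X]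

/-- running maximum of the distance to `G q` -/
noncomputable def runMax (G : ℝ → X) (q t : ℝ) : ℝ :=
  sSup ((fun r => dist (G (max q (min r t))) (G q)) '' Icc 0 1)

theorem runMax_continuous {G : ℝ → X} (hG : Continuous G) (q : ℝ) : Continuous (runMax G q) := by
  unfold runMax
  refine IsCompact.continuous_sSup (f := fun t r => dist (G (max q (min r t))) (G q)) isCompact_Icc ?_
  change Continuous fun p : ℝ × ℝ => dist (G (max q (min p.2 p.1))) (G q)
  fun_prop

theorem le_runMax {G : ℝ → X} (hG : Continuous G) (q t : ℝ) {r : ℝ} (hr : r ∈ Icc (0 : ℝ) 1) :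
    dist (G (max q (min r t))) (G q) ≤ runMax G q t := by
  refine le_csSup ?_ ⟨r, hr, rfl⟩
  refine (isCompact_Icc.image ?_).bddAbove
  fun_prop

theorem runMax_le {G : ℝ → X} (q t : ℝ) {B : ℝ}
    (h : ∀ r ∈ Icc (0 : ℝ) 1, dist (G (max q (min r t))) (G q) ≤ B) : runMax G q t ≤ B := by
  refine csSup_le ⟨_, 0, by simp, rfl⟩ ?_
  rintro _ ⟨r, hr, rfl⟩
  exact h r hr

theorem runMax_nonneg {G : ℝ → X} (hG : Continuous G) (q t : ℝ) : 0 ≤ runMax G q t :=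
  dist_nonneg.trans (le_runMax hG q t (r := 0) (by simp))

theorem runMax_mono {G : ℝ → X} (hG : Continuous G) (q : ℝ) {s t : ℝ} (hs : 0 ≤ s) (hst : s ≤ t) :
    runMax G q s ≤ runMax G q t := by
  refine runMax_le q s fun r hr => ?_
  have := le_runMax hG q t (r := min r s) ⟨le_min hr.1 hs, (min_le_left _ _).trans hr.2⟩
  rwa [min_assoc, min_eq_left hst] at this

theorem runMax_fib {G : ℝ → X} (hG : Continuous G)
    (hfib : ∀ s r t, s ≤ r → r ≤ t → G s = G t → G r = G s) (q : ℝ) {s t : ℝ}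
    (hs : s ∈ Icc (0 : ℝ) 1) (hst : s ≤ t) (h : G s = G t) : runMax G q s = runMax G q t := by
  refine le_antisymm (runMax_mono hG q hs.1 hst) (runMax_le q t fun r hr => ?_)
  rcases le_or_gt r s with hrs | hrs
  · have := le_runMax hG q s hr
    rw [min_eq_left hrs] at this
    rw [min_eq_left (hrs.trans hst)]
    exact this
  · have hm : s ≤ min r t := le_min hrs.le hst
    have hmt : min r t ≤ t := min_le_right _ _
    rcases le_total (min r t) q with hq | hq
    · rw [max_eq_left hq, dist_self]; exact runMax_nonneg hG q s
    · rw [max_eq_right hq, hfib s _ t hm hmt h]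
      rcases le_total q s with hqs | hqs
      · have := le_runMax hG q s hs
        rwa [min_self, max_eq_right hqs] at this
      · rw [hfib s q t hqs (hq.trans hmt) h, dist_self]; exact runMax_nonneg hG q s

theorem exists_height {G : ℝ → X} (hG : Continuous G)
    (hfib : ∀ s r t, s ≤ r → r ≤ t → G s = G t → G r = G s) :
    ∃ h : ℝ → ℝ, Continuous h ∧ (∀ s ∈ Icc (0 : ℝ) 1, ∀ t ∈ Icc (0 : ℝ) 1, s ≤ t →
      h s ≤ h t ∧ (h s = h t ↔ G s = G t)) := by
  let e : ℚ → ℝ → ℝ := fun q t => (1 / 2 : ℝ) ^ Encodable.encode q * min 1 (runMax G q t)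
  have hbd : ∀ q t, ‖e q t‖ ≤ (1 / 2 : ℝ) ^ Encodable.encode q := by
    intro q t
    have h1 : 0 ≤ min 1 (runMax G q t) := le_min zero_le_one (runMax_nonneg hG _ _)
    have h2 : min 1 (runMax G q t) ≤ 1 := min_le_left _ _
    rw [Real.norm_of_nonneg (by positivity)]
    exact mul_le_of_le_one_right (by positivity) h2
  have hsum : ∀ t, Summable fun q => e q t := fun t =>
    Summable.of_norm_bounded summable_geometric_two_encode (fun q => hbd q t)
  have hmono : ∀ q s t, 0 ≤ s → s ≤ t → e q s ≤ e q t := fun q s t hs hst =>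
    mul_le_mul_of_nonneg_left (min_le_min le_rfl (runMax_mono hG _ hs hst)) (by positivity)
  refine ⟨fun t => ∑' q, e q t, ?_, ?_⟩
  · refine continuous_tsum (fun q => ?_) summable_geometric_two_encode hbd
    exact continuous_const.mul (continuous_const.min (runMax_continuous hG _))
  · intro s hs t ht hst
    refine ⟨Summable.tsum_le_tsum (fun q => hmono q s t hs.1 hst) (hsum s) (hsum t), ?_, ?_⟩
    · intro heq
      by_contra hne
      have hlt : s < t := lt_of_le_of_ne hst fun h => hne (by rw [h])
      have hopen : IsOpen {r | G r ≠ G t} := isOpen_ne_fun hG continuous_const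
      obtain ⟨δ, hδ, hball⟩ := Metric.isOpen_iff.1 hopen s hne
      obtain ⟨q, hq1, hq2⟩ := exists_rat_btwn (show s < min t (s + δ) from lt_min hlt (by linarith))
      have hqt : (q : ℝ) < t := hq2.trans_le (min_le_left _ _)
      have hGq : G q ≠ G t := hball (by
        rw [Metric.mem_ball, Real.dist_eq, abs_lt]
        have := hq2.trans_le (min_le_right _ _)
        constructor <;> linarith)
      refine heq.not_lt (Summable.tsum_lt_tsum (i := q) (fun q => hmono q s t hs.1 hst) ?_
        (hsum s) (hsum t))
      refine mul_lt_mul_of_pos_left ?_ (by positivity)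
      have h0 : runMax G q s ≤ 0 := runMax_le _ _ fun r hr => by
        rw [max_eq_left ((min_le_right _ _).trans hq1.le), dist_self]
      have h1 : 0 < runMax G q t := by
        refine lt_of_lt_of_le ?_ (le_runMax hG q t ht)
        rw [min_self, max_eq_right hqt.le]
        exact dist_pos.2 hGq.symm
      exact (min_le_right _ _).trans_lt (h0.trans_lt (lt_min zero_lt_one h1))
    · intro h
      refine tsum_congr fun q => ?_
      simp only [e]
      rw [runMax_fib hG hfib q hs hst h]

/-- `f` restricts to an arc on `[a,b]` from `x` to `y`. -/
def IsArcOn {X : Type*} [TopologicalSpace X] (f : ℝ → X) (a b : ℝ) : Prop :=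
  Continuous f ∧ a < b ∧ InjOn f (Icc a b)

theorem exists_arc_of_path {F : ℝ → X} (hF : Continuous F) (hne : F 0 ≠ F 1) :
    ∃ (f : ℝ → X) (a b : ℝ), IsArcOn f a b ∧ f a = F 0 ∧ f b = F 1 := by
  obtain ⟨G, hG, h0, h1, hfib⟩ := exists_monotone_path hF
  obtain ⟨h, hh, hmono⟩ := exists_height hG hfib
  rw [← h0, ← h1] at hne ⊢
  have m0 : (0 : ℝ) ∈ Icc (0 : ℝ) 1 := by simp
  have m1 : (1 : ℝ) ∈ Icc (0 : ℝ) 1 := by simp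
  have hiff : ∀ s ∈ Icc (0 : ℝ) 1, ∀ t ∈ Icc (0 : ℝ) 1, (h s = h t ↔ G s = G t) := by
    intro s hs t ht
    rcases le_total s t with hst | hst
    · exact (hmono s hs t ht hst).2
    · have := (hmono t ht s hs hst).2
      rw [eq_comm, this, eq_comm]
  have hlt : h 0 < h 1 := lt_of_le_of_ne (hmono 0 m0 1 m1 zero_le_one).1
    fun e => hne ((hiff 0 m0 1 m1).1 e)
  have hsurj : ∀ v ∈ Icc (h 0) (h 1), ∃ t ∈ Icc (0 : ℝ) 1, h t = v := fun v hv =>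
    intermediate_value_Icc zero_le_one hh.continuousOn hv
  choose! ρ hρ hρh using hsurj
  have hcont : ContinuousOn (fun v => G (ρ v)) (Icc (h 0) (h 1)) := by
    rw [continuousOn_iff_isClosed]
    intro C hC
    refine ⟨h '' (G ⁻¹' C ∩ Icc 0 1), ?_, ?_⟩
    · exact ((isCompact_Icc.inter_left (hC.preimage hG)).image hh).isClosed
    · ext v
      constructor
      · rintro ⟨hv, hvI⟩
        exact ⟨⟨ρ v, ⟨hv, hρ v hvI⟩, hρh v hvI⟩, hvI⟩
      · rintro ⟨⟨t, ⟨htC, ht⟩, rfl⟩, hvI⟩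
        refine ⟨?_, hvI⟩
        have : G (ρ (h t)) = G t := (hiff _ (hρ _ hvI) _ ht).1 (hρh _ hvI)
        change G (ρ (h t)) ∈ C
        rw [this]; exact htC
  let cl : ℝ → ℝ := fun v => max (h 0) (min (h 1) v)
  have hcl : ∀ v ∈ Icc (h 0) (h 1), cl v = v := fun v hv => by
    simp only [cl]
    rw [min_eq_right hv.2, max_eq_right hv.1]
  have hclm : ∀ v, cl v ∈ Icc (h 0) (h 1) := fun v =>
    ⟨le_max_left _ _, max_le hlt.le (min_le_left _ _)⟩
  have e0 : h 0 ∈ Icc (h 0) (h 1) := ⟨le_rfl, hlt.le⟩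
  have e1 : h 1 ∈ Icc (h 0) (h 1) := ⟨hlt.le, le_rfl⟩
  refine ⟨fun v => G (ρ (cl v)), h 0, h 1, ⟨?_, hlt, ?_⟩, ?_, ?_⟩
  · exact hcont.comp_continuous (by fun_prop) hclm
  · intro v hv w hw hvw
    simp only at hvw
    rw [hcl v hv, hcl w hw] at hvw
    rw [← hρh v hv, ← hρh w hw]
    exact (hiff _ (hρ v hv) _ (hρ w hw)).2 hvw
  · simp only [hcl _ e0]
    exact (hiff _ (hρ _ e0) _ m0).1 (hρh _ e0)
  · simp only [hcl _ e1]
    exact (hiff _ (hρ _ e1) _ m1).1 (hρh _ e1)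

theorem exists_circle {X : Type*} [TopologicalSpace X] [T2Space X] {f g : ℝ → X} {a b c d : ℝ}
    (hf : IsArcOn f a b) (hg : IsArcOn g c d)
    (h0 : f a = g c) (h1 : f b = g d) (hd : ∀ t ∈ Ioo a b, ∀ u ∈ Icc c d, f t ≠ g u) :
    ∃ S : Set X, Nonempty (S ≃ₜ Circle) := by
  obtain ⟨hfc, hab, hfi⟩ := hf
  obtain ⟨hgc, hcd, hgi⟩ := hg
  let p : ℝ := (b - a) + (d - c)
  have hp : 0 < p := by simp only [p]; linarith
  have : Fact (0 < p) := ⟨hp⟩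
  let k : ℝ → X := fun t => if t ≤ b then f t else g (d - (t - b))
  have hk : Continuous k := by
    refine Continuous.if_le hfc (by fun_prop) continuous_id continuous_const ?_
    rintro t rfl
    simp [h1]
  have hper : k a = k (a + p) := by
    have : ¬ a + p ≤ b := by simp only [p]; linarith
    simp only [k, if_pos hab.le, if_neg this, h0]
    congr 1
    simp only [p]; ring
  have hmix : ∀ s ∈ Ico a (a + p), ∀ t ∈ Ico a (a + p), s ≤ b → ¬ t ≤ b → k s ≠ k t := by
    intro s hs t ht hsb htb he
    simp only [k, if_pos hsb, if_neg htb] at he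
    push Not at htb
    have ht2 := ht.2
    simp only [p] at ht2
    have hu : d - (t - b) ∈ Icc c d := ⟨by linarith, by linarith⟩
    rcases eq_or_lt_of_le hsb with e | hsb
    · rw [e, h1] at he
      have := hgi ⟨hcd.le, le_rfl⟩ hu he
      linarith
    · rcases eq_or_lt_of_le hs.1 with e | hsa
      · rw [← e, h0] at he
        have := hgi ⟨le_rfl, hcd.le⟩ hu he
        linarith
      · exact hd s ⟨hsa, hsb⟩ _ hu he
  have hinj : InjOn k (Ico a (a + p)) := by
    intro s hs t ht he
    by_cases hsb : s ≤ b
    · by_cases htb : t ≤ b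
      · simp only [k, if_pos hsb, if_pos htb] at he
        exact hfi ⟨hs.1, hsb⟩ ⟨ht.1, htb⟩ he
      · exact absurd he (hmix s hs t ht hsb htb)
    · by_cases htb : t ≤ b
      · exact absurd he.symm (hmix t ht s hs htb hsb)
      · simp only [k, if_neg hsb, if_neg htb] at he
        push Not at hsb htb
        have hs2 := hs.2
        have ht2 := ht.2
        simp only [p] at hs2 ht2
        have := hgi ⟨by linarith, by linarith⟩ ⟨by linarith, by linarith⟩ he
        linarith
  let φ : AddCircle p → X := AddCircle.liftIco p a k
  have hφc : Continuous φ := AddCircle.liftIco_continuous hper hk.continuousOn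
  have hφi : Function.Injective φ := by
    intro u v huv
    have hu := (AddCircle.equivIco p a u).2
    have hv := (AddCircle.equivIco p a v).2
    exact (AddCircle.equivIco p a).injective (Subtype.ext (hinj hu hv huv))
  have hemb := (hφc.isClosedEmbedding hφi).isEmbedding
  exact ⟨range φ, ⟨hemb.toHomeomorph.symm.trans (AddCircle.homeomorphCircle hp.ne')⟩⟩

end reparam

section topo
variable {X : Type*} [TopologicalSpace X]

/-- `x` and `y` lie in a connected set that misses `p`. -/
def JoinedOff (p x y : X) : Prop :=
  ∃ C : Set X, IsPreconnected C ∧ p ∉ C ∧ x ∈ C ∧ y ∈ C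

theorem exists_arc_in [CompactSpace X] [TopologicalSpace.MetrizableSpace X]
    [LocallyConnectedSpace X] {U : Set X} (hU : IsOpen U) (hc : IsPreconnected U) {x y : X}
    (hx : x ∈ U) (hy : y ∈ U) (hne : x ≠ y) :
    ∃ (f : ℝ → X) (a b : ℝ), IsArcOn f a b ∧ f a = x ∧ f b = y ∧ ∀ t, f t ∈ U := by
  have : PolishSpace X := by
    let _ : MetricSpace X := TopologicalSpace.metrizableSpaceMetric X
    infer_instance
  have : PolishSpace U := hU.polishSpace
  have : LocallyConnectedSpace U := hU.locallyConnectedSpace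
  have : PreconnectedSpace U := isPreconnected_iff_preconnectedSpace.1 hc
  let _ := TopologicalSpace.upgradeIsCompletelyMetrizable U
  obtain ⟨F, hF, h0, h1⟩ := exists_path (⟨x, hx⟩ : U) ⟨y, hy⟩
  obtain ⟨f, a, b, ⟨hf, hab, hi⟩, ha, hb⟩ := exists_arc_of_path hF (by
    rw [h0, h1]; intro h; exact hne (congrArg Subtype.val h))
  refine ⟨fun t => (f t : X), a, b, ⟨by fun_prop, hab, fun s hs t ht h => hi hs ht (Subtype.ext h)⟩,
    ?_, ?_, fun t => (f t).2⟩
  · simp [ha, h0]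
  · simp [hb, h1]

theorem IsArcOn.sub {f : ℝ → X} {a b a' b' : ℝ} (h : IsArcOn f a b) (h1 : a ≤ a') (h2 : a' < b')
    (h3 : b' ≤ b) : IsArcOn f a' b' :=
  ⟨h.1, h2, h.2.2.mono (Icc_subset_Icc h1 h3)⟩

theorem IsArcOn.rev {f : ℝ → X} {a b : ℝ} (h : IsArcOn f a b) :
    IsArcOn (fun t => f (-t)) (-b) (-a) := by
  refine ⟨h.1.comp continuous_neg, by linarith [h.2.1], fun s hs t ht he => ?_⟩
  have := h.2.2 ⟨by linarith [hs.2], by linarith [hs.1]⟩ ⟨by linarith [ht.2], by linarith [ht.1]⟩ he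
  linarith

theorem joinedOff_irr (p x : X) : ¬ JoinedOff p p x := fun ⟨_, _, h, h', _⟩ => h h'

theorem JoinedOff.symm {p x y : X} (h : JoinedOff p x y) : JoinedOff p y x := by
  obtain ⟨C, h1, h2, h3, h4⟩ := h
  exact ⟨C, h1, h2, h4, h3⟩

theorem JoinedOff.trans {p x y z : X} (h : JoinedOff p x y) (h' : JoinedOff p y z) :
    JoinedOff p x z := by
  obtain ⟨C, h1, h2, h3, h4⟩ := h
  obtain ⟨C', h1', h2', h3', h4'⟩ := h'
  exact ⟨C ∪ C', h1.union y h4 h3' h1', by simp [h2, h2'], Or.inl h3, Or.inr h4'⟩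

theorem joinedOff_cover [T1Space X] [ConnectedSpace X] [LocallyConnectedSpace X] (p q z : X)
    (hpq : p ≠ q) : JoinedOff p q z ∨ JoinedOff q p z := by
  by_cases hj : JoinedOff p q z
  · exact Or.inl hj
  right
  by_cases hz : z = p
  · subst hz
    exact ⟨{z}, isPreconnected_singleton, by simpa using hpq.symm, rfl, rfl⟩
  set D := connectedComponentIn ({p}ᶜ : Set X) z with hD
  have hzD : z ∈ D := mem_connectedComponentIn (by simpa using hz)
  have hDp : D ⊆ {p}ᶜ := connectedComponentIn_subset _ _
  have hDo : IsOpen D := isOpen_compl_singleton.connectedComponentIn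
  have hDc : IsPreconnected D := isPreconnected_connectedComponentIn
  have hp : p ∈ closure D := by
    by_contra hn
    have hsub : closure D ⊆ D := hDc.closure.subset_connectedComponentIn (subset_closure hzD)
      (fun x hx hxp => hn (hxp ▸ hx))
    have hcl : IsClosed D := isClosed_of_closure_subset hsub
    have : D = univ := IsClopen.eq_univ ⟨hcl, hDo⟩ ⟨z, hzD⟩
    exact hDp (this ▸ mem_univ p) rfl
  refine ⟨insert p D, hDc.subset_closure (subset_insert _ _)
    (insert_subset hp subset_closure), ?_, mem_insert _ _, mem_insert_of_mem _ hzD⟩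
  rintro (h | h)
  · exact hpq h.symm
  · exact hj ⟨D, hDc, fun h => hDp h rfl, h, hzD⟩

theorem arc_separates [CompactSpace X] [TopologicalSpace.MetrizableSpace X]
    [LocallyConnectedSpace X] (hno : ¬ ∃ S : Set X, Nonempty (S ≃ₜ Circle))
    {f : ℝ → X} {a b t : ℝ} (hf : IsArcOn f a b) (ht : t ∈ Icc a b) :
    ¬ JoinedOff (f t) (f a) (f b) := by
  rintro ⟨C, hC, htC, haC, hbC⟩
  have hta : a < t := lt_of_le_of_ne ht.1 fun h => htC (h ▸ haC)
  have htb : t < b := lt_of_le_of_ne ht.2 fun h => htC (h ▸ hbC)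
  set D := connectedComponentIn ({f t}ᶜ : Set X) (f a) with hD
  have hCt : C ⊆ {f t}ᶜ := fun x hx hxt => htC (hxt ▸ hx)
  have haD : f a ∈ D := mem_connectedComponentIn (hCt haC)
  have hbD : f b ∈ D := hC.subset_connectedComponentIn haC hCt hbC
  have hDp : D ⊆ {f t}ᶜ := connectedComponentIn_subset _ _
  have hDo : IsOpen D := isOpen_compl_singleton.connectedComponentIn
  have hDc : IsPreconnected D := isPreconnected_connectedComponentIn
  have hab : f a ≠ f b := fun h =>
    hf.2.1.ne (hf.2.2 ⟨le_rfl, hf.2.1.le⟩ ⟨hf.2.1.le, le_rfl⟩ h)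
  obtain ⟨g, c, d, hg, hgc, hgd, hgD⟩ := exists_arc_in hDo hDc haD hbD hab
  let K : Set ℝ := f ⁻¹' (g '' Icc c d)
  have hK : IsClosed K := ((isCompact_Icc.image hg.1).isClosed).preimage hf.1
  have htK : t ∉ K := by
    rintro ⟨u, _, hu⟩
    exact hDp (hgD u) hu
  have haK : a ∈ K := ⟨c, ⟨le_rfl, hg.2.1.le⟩, hgc⟩
  have hbK : b ∈ K := ⟨d, ⟨hg.2.1.le, le_rfl⟩, hgd⟩
  obtain ⟨s1, hs1, has1, hs1t, hs1max⟩ := exists_greatest_le hK haK hta.le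
  obtain ⟨s2, hs2, hs2b, hts2, hs2min⟩ := exists_least_ge hK hbK htb.le
  have h1 : s1 < t := lt_of_le_of_ne hs1t fun h => htK (h ▸ hs1)
  have h2 : t < s2 := lt_of_le_of_ne hts2 fun h => htK (h ▸ hs2)
  have hgap : ∀ r ∈ Ioo s1 s2, ∀ u ∈ Icc c d, f r ≠ g u := by
    intro r hr u hu he
    have hrK : r ∈ K := ⟨u, hu, he.symm⟩
    rcases le_total r t with h | h
    · linarith [hs1max r hrK h, hr.1]
    · linarith [hs2min r hrK h, hr.2]
  have hf' : IsArcOn f s1 s2 := hf.sub has1 (h1.trans h2) hs2b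
  have hne : f s1 ≠ f s2 := fun h =>
    hf'.2.1.ne (hf'.2.2 ⟨le_rfl, hf'.2.1.le⟩ ⟨hf'.2.1.le, le_rfl⟩ h)
  obtain ⟨u1, hu1, e1⟩ := hs1
  obtain ⟨u2, hu2, e2⟩ := hs2
  rcases lt_trichotomy u1 u2 with h | h | h
  · exact hno (exists_circle hf' (hg.sub hu1.1 h hu2.2) e1.symm e2.symm fun r hr u hu =>
      hgap r hr u ⟨hu1.1.trans hu.1, hu.2.trans hu2.2⟩)
  · exact hne (by rw [← e1, ← e2, h])
  · refine hno (exists_circle hf' (hg.sub hu2.1 h hu1.2).rev (by simp [e1]) (by simp [e2])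
      fun r hr u hu => hgap r hr (-u) ⟨?_, ?_⟩)
    · linarith [hu.2, hu2.1]
    · linarith [hu.1, hu1.2]

theorem IsArcOn.concat {f g : ℝ → X} {a b c d : ℝ} (hf : IsArcOn f a b) (hg : IsArcOn g c d)
    (he : f b = g c) (hd : ∀ s ∈ Icc a b, s ≠ b → ∀ u ∈ Icc c d, f s ≠ g u) :
    ∃ (k : ℝ → X) (l m : ℝ), IsArcOn k l m ∧ k l = f a ∧ k m = g d ∧
      ∃ t ∈ Icc l m, k t = f b := by
  obtain ⟨hfc, hab, hfi⟩ := hf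
  obtain ⟨hgc, hcd, hgi⟩ := hg
  let k : ℝ → X := fun t => if t ≤ b then f t else g (c + (t - b))
  have hk : Continuous k := by
    refine Continuous.if_le hfc (by fun_prop) continuous_id continuous_const ?_
    rintro t rfl
    simp [he]
  have hmix : ∀ s ∈ Icc a (b + (d - c)), ∀ t ∈ Icc a (b + (d - c)), s ≤ b → ¬ t ≤ b →
      k s ≠ k t := by
    intro s hs t ht hsb htb h
    simp only [k, if_pos hsb, if_neg htb] at h
    push Not at htb
    have hu : c + (t - b) ∈ Icc c d := ⟨by linarith, by linarith [ht.2]⟩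
    by_cases e : s = b
    · rw [e, he] at h
      have := hgi ⟨le_rfl, hcd.le⟩ hu h
      linarith
    · exact hd s ⟨hs.1, hsb⟩ e _ hu h
  refine ⟨k, a, b + (d - c), ⟨hk, by linarith, ?_⟩, ?_, ?_, b, ⟨hab.le, by linarith⟩, ?_⟩
  · intro s hs t ht h
    by_cases hsb : s ≤ b
    · by_cases htb : t ≤ b
      · simp only [k, if_pos hsb, if_pos htb] at h
        exact hfi ⟨hs.1, hsb⟩ ⟨ht.1, htb⟩ h
      · exact absurd h (hmix s hs t ht hsb htb)
    · by_cases htb : t ≤ b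
      · exact absurd h.symm (hmix t ht s hs htb hsb)
      · simp only [k, if_neg hsb, if_neg htb] at h
        push Not at hsb htb
        have := hgi ⟨by linarith, by linarith [hs.2]⟩ ⟨by linarith, by linarith [ht.2]⟩ h
        linarith
  · simp [k, hab.le]
  · have : ¬ b + (d - c) ≤ b := by linarith
    simp only [k, if_neg this]
    congr 1; ring
  · simp [k]

theorem joinedOff_median [CompactSpace X] [ConnectedSpace X] [TopologicalSpace.MetrizableSpace X]
    [LocallyConnectedSpace X] (hno : ¬ ∃ S : Set X, Nonempty (S ≃ₜ Circle)) (x y z : X)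
    (hxy : x ≠ y) (hxz : x ≠ z) :
    ∃ w, ¬ JoinedOff w x y ∧ ¬ JoinedOff w y z ∧ ¬ JoinedOff w x z := by
  obtain ⟨f, a, b, hf, fa, fb, -⟩ := exists_arc_in isOpen_univ isPreconnected_univ
    (mem_univ x) (mem_univ y) hxy
  obtain ⟨g, c, d, hg, gc, gd, -⟩ := exists_arc_in isOpen_univ isPreconnected_univ
    (mem_univ z) (mem_univ x) hxz.symm
  let K : Set ℝ := g ⁻¹' (f '' Icc a b) ∩ Ici c
  have hK : IsClosed K :=
    (((isCompact_Icc.image hf.1).isClosed).preimage hg.1).inter isClosed_Ici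
  have hdK : d ∈ K := ⟨⟨a, ⟨le_rfl, hf.2.1.le⟩, by rw [fa, gd]⟩, hg.2.1.le⟩
  obtain ⟨u, ⟨⟨t, ht, e⟩, _⟩, hud, hcu, humin⟩ := exists_least_ge hK hdK hg.2.1.le
  have k1 : ¬ JoinedOff (g u) x y := by
    have := arc_separates hno hf ht
    rwa [e, fa, fb] at this
  have k2 : ¬ JoinedOff (g u) z x := by
    have := arc_separates hno hg (t := u) ⟨hcu, hud⟩
    rwa [gc, gd] at this
  refine ⟨g u, k1, ?_, fun h => k2 h.symm⟩
  rcases eq_or_lt_of_le hcu with h | hcu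
  · rw [← h, gc]
    exact fun h => joinedOff_irr _ _ h.symm
  rcases eq_or_lt_of_le ht.2 with h | htb
  · rw [← e, h, fb]
    exact joinedOff_irr _ _
  obtain ⟨k, l, m, hk, kl, km, r, hr, kr⟩ := (hg.sub le_rfl hcu hud).concat (hf.sub ht.1 htb le_rfl)
    e.symm (by
      intro s hs hsu v hv he
      have : s ∈ K := ⟨⟨v, ⟨ht.1.trans hv.1, hv.2⟩, he.symm⟩, hs.1⟩
      exact hsu (le_antisymm hs.2 (humin s this hs.1)))
  have := arc_separates hno hk hr
  rw [kr, kl, km, gc, fb] at this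
  exact fun h => this h.symm

end topo

/-- A group acting by homeomorphisms on a dendrite and preserving a finite nonempty
set is elementary: it fixes a point or preserves a set of exactly two points. -/
theorem elementary_of_invariant_finite_set (G X : Type*) [Group G] [TopologicalSpace X]
    [MulAction G X] (hcont : ∀ g : G, Continuous fun x : X => g • x)
    (hX : IsDendrite X) (A : Set X) (hfin : A.Finite)
    (hne : A.Nonempty) (hinv : ∀ g : G, (g • ·) '' A = A) :
    ElementaryAction G X := by
  obtain ⟨_, hcomp, hconn, hmet, hloc, hno⟩ := hX
  have hsep : SepData X JoinedOff :=
    { irr := joinedOff_irr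
      refl := fun p x hx => ⟨{x}, isPreconnected_singleton, fun h => hx h.symm, rfl, rfl⟩
      symm := fun p x y h => h.symm
      trans := fun p x y z h h' => h.trans h'
      cover := joinedOff_cover
      median := fun x y z hxy _ hxz => joinedOff_median hno x y z hxy hxz }
  have heq : ∀ (g : G) (p x y : X), JoinedOff p x y → JoinedOff (g • p) (g • x) (g • y) := by
    rintro g p x y ⟨C, h1, h2, h3, h4⟩
    refine ⟨(g • ·) '' C, h1.image _ (hcont g).continuousOn, ?_, ⟨x, h3, rfl⟩, ⟨y, h4, rfl⟩⟩
    rintro ⟨q, hq, he⟩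
    have : q = p := by simpa using he
    exact h2 (this ▸ hq)
  have hinv' : ∀ (g : G), ∀ a ∈ A, g • a ∈ A := fun g a ha => by
    rw [← hinv g]; exact ⟨a, ha, rfl⟩
  refine comb_main hsep heq _ (medSet JoinedOff A) rfl (hsep.finite_medSet hfin)
    (hne.mono (hsep.subset_medSet A)) (hsep.medClosed_medSet A) ?_
  rintro g w ⟨a, ha, b, hb, c, hc, h1, h2, h3⟩
  have heq' : ∀ x y, ¬ JoinedOff w x y → ¬ JoinedOff (g • w) (g • x) (g • y) := by
    intro x y hj hj'
    have := heq g⁻¹ _ _ _ hj'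
    simp only [inv_smul_smul] at this
    exact hj this
  exact ⟨g • a, hinv' g a ha, g • b, hinv' g b hb, g • c, hinv' g c hc,
    heq' _ _ h1, heq' _ _ h2, heq' _ _ h3⟩
end

section
/- Let G be a group acting by homeomorphisms on a dendrite X with no G-invariant proper nonempty sub-dendrite (dendro-minimality). Then for every proper sub-dendrite Y ⊊ X there exists g ∈ G with gY ∩ Y = ∅. -/
open Set

/-- An action is dendro-minimal if there is no proper invariant sub-dendrite
(nonempty closed connected invariant subset other than the whole space). -/
def DendroMinimal (G X : Type*) [Group G] [TopologicalSpace X] [MulAction G X] : Prop :=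
  ∀ Y : Set X, Y.Nonempty → IsClosed Y → IsPreconnected Y →
    (∀ g : G, (g • ·) '' Y = Y) → Y = univ


section PathPart
open Metric Filter Topology

variable {X : Type*} [MetricSpace X]

lemma chain_of_preconnected {S : Set X} (hS : IsPreconnected S) {δ : ℝ} (hδ : 0 < δ) {a b : X}
    (ha : a ∈ S) (hb : b ∈ S) :
    ∃ (m : ℕ) (R : ℕ → X), R 0 = a ∧ (∀ i, m ≤ i → R i = b) ∧
      (∀ i, dist (R i) (R (i + 1)) < δ) ∧ ∀ i, R i ∈ S := by
  let r : X → X → Prop := fun x y => dist x y < δ ∧ x ∈ S ∧ y ∈ S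
  have hr : Relation.ReflTransGen r a b := by
    refine hS.induction₂' (Relation.ReflTransGen r) ?_ ?_ ha hb
    · intro x hx
      have : ∀ᶠ y in 𝓝[S] x, dist y x < δ :=
        nhdsWithin_le_nhds (ball_mem_nhds x hδ)
      filter_upwards [this, self_mem_nhdsWithin] with y hy hyS
      exact ⟨.single ⟨by rwa [dist_comm], hx, hyS⟩, .single ⟨hy, hyS, hx⟩⟩
    · intro x y z _ _ _ h1 h2
      exact h1.trans h2
  induction hr with
  | refl => exact ⟨0, fun _ => a, rfl, fun _ _ => rfl, by simpa using hδ, fun _ => ha⟩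
  | @tail b c _ hbc ih =>
    obtain ⟨m, R, h0, hm, hs, hin⟩ := ih hbc.2.1
    refine ⟨m + 1, fun i => if i ≤ m then R i else c, by simpa using h0, ?_, ?_, ?_⟩
    · intro i hi
      simp [show ¬ i ≤ m by omega]
    · intro i
      rcases lt_trichotomy i m with h | h | h
      · simpa [show i ≤ m by omega, show i + 1 ≤ m by omega] using hs i
      · simpa [show i ≤ m by omega, show ¬ i + 1 ≤ m by omega, hm i h.ge] using hbc.1
      · simpa [show ¬ i ≤ m by omega, show ¬ i + 1 ≤ m by omega] using hδ
    · intro i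
      dsimp only
      split_ifs
      · exact hin i
      · exact hbc.2.2

lemma unif_loc_conn [CompactSpace X] [LocallyConnectedSpace X] {ε : ℝ} (hε : 0 < ε) :
    ∃ δ > 0, ∀ x y : X, dist x y < δ → ∃ C : Set X, IsPreconnected C ∧ x ∈ C ∧ y ∈ C ∧
      C ⊆ ball x ε := by
  have h := fun x : X => locallyConnectedSpace_iff_subsets_isOpen_isConnected.1
    inferInstance x (ball x (ε / 2)) (ball_mem_nhds x (half_pos hε))
  choose V hV hVo hxV hVc using h
  obtain ⟨δ, hδ, H⟩ := lebesgue_number_lemma_of_metric (isCompact_univ (X := X)) hVo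
    (fun x _ => mem_iUnion.2 ⟨x, hxV x⟩)
  refine ⟨δ, hδ, fun x y hxy => ?_⟩
  obtain ⟨z, hz⟩ := H x trivial
  refine ⟨V z, (hVc z).isPreconnected, hz (mem_ball_self hδ), hz (by rwa [mem_ball, dist_comm]), ?_⟩
  intro w hw
  have h1 := hV z hw
  have h2 := hV z (hz (mem_ball_self hδ))
  rw [mem_ball] at *
  linarith [dist_triangle_right w x z]

lemma exists_small_path [CompactSpace X] [LocallyConnectedSpace X] {r : ℝ} (hr : 0 < r) :
    ∃ δ > 0, ∀ x y : X, dist x y < δ → JoinedIn (ball x (3 * r)) x y := by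
  have hpow : ∀ n : ℕ, 0 < r / 2 / 2 ^ n := fun n => by positivity
  choose D hD0 hD using fun n : ℕ => unif_loc_conn (X := X) (hpow n)
  let δ : ℕ → ℝ := fun n => min (D n) (r / 2 / 2 ^ n)
  have hδ0 : ∀ n, 0 < δ n := fun n => lt_min (hD0 n) (hpow n)
  refine ⟨δ 0, hδ0 0, fun x y hxy => ?_⟩
  -- chains
  have hch : ∀ n (a b : X), ∃ (m : ℕ) (R : ℕ → X), dist a b < δ n → R 0 = a ∧
      (∀ i, m ≤ i → R i = b) ∧
      (∀ i, dist (R i) (R (i + 1)) < δ (n + 1)) ∧ (∀ i, dist (R i) a ≤ r / 2 / 2 ^ n) ∧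
      (a = b → ∀ i, R i = a) := by
    intro n a b
    by_cases hab : a = b
    · subst hab
      exact ⟨0, fun _ => a, fun _ => ⟨rfl, fun _ _ => rfl, by simpa using hδ0 (n + 1),
        fun _ => by simpa using (hpow n).le, fun _ _ => rfl⟩⟩
    by_cases h : dist a b < δ n
    · obtain ⟨C, hC, haC, hbC, hCb⟩ := hD n a b (h.trans_le (min_le_left _ _))
      obtain ⟨m, R, h1, h2, h3, h4⟩ := chain_of_preconnected hC (hδ0 (n + 1)) haC hbC
      exact ⟨m, R, fun _ => ⟨h1, h2, h3, fun i => (mem_ball.1 (hCb (h4 i))).le,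
        fun h => absurd h hab⟩⟩
    · exact ⟨0, fun _ => a, fun h' => absurd h' h⟩
  choose m R hR using hch
  let P : ℕ → ℕ × (ℕ → X) → Prop := fun n s => 1 ≤ s.1 ∧ s.2 0 = x ∧ (∀ i, s.1 ≤ i → s.2 i = y) ∧
    ∀ i, dist (s.2 i) (s.2 (i + 1)) < δ n
  have hstep : ∀ n (s : ℕ × (ℕ → X)), ∃ s' : ℕ × (ℕ → X), P n s → P (n + 1) s' ∧ ∃ M, 1 ≤ M ∧
      s'.1 = s.1 * M ∧ ∀ k, dist (s'.2 k) (s.2 (k / M)) ≤ r / 2 / 2 ^ n := by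
    rintro n ⟨N, c⟩
    let M := 1 + (Finset.range (N + 1)).sup fun i => m n (c i) (c (i + 1))
    refine ⟨⟨N * M, fun k => R n (c (k / M)) (c (k / M + 1)) (k % M)⟩, ?_⟩
    rintro ⟨hN, h0, hy, hs⟩
    dsimp only at hN h0 hy hs
    have hM1 : 1 ≤ M := Nat.le_add_right _ _
    have hM : ∀ i, m n (c i) (c (i + 1)) ≤ M := by
      have key : ∀ i, i ≤ N → m n (c i) (c (i + 1)) ≤ M := by
        intro i hi
        have := Finset.le_sup (f := fun i => m n (c i) (c (i + 1)))
          (Finset.mem_range.2 (Nat.lt_succ_of_le hi))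
        exact this.trans (Nat.le_add_left _ _)
      intro i
      by_cases hi : i ≤ N
      · exact key i hi
      · have := key N le_rfl
        rw [hy N le_rfl, hy (N + 1) (by omega)] at this
        rwa [hy i (by omega), hy (i + 1) (by omega)]
    have hRR := fun i => hR n (c i) (c (i + 1)) (hs i)
    refine ⟨⟨Nat.mul_pos hN hM1, ?_, ?_, ?_⟩, M, hM1, rfl, ?_⟩
    · simpa [h0] using (hRR 0).1
    · intro i hi
      dsimp only at hi ⊢
      have hq : N ≤ i / M := (Nat.le_div_iff_mul_le hM1).2 hi
      rw [(hRR (i / M)).2.2.2.2 (by rw [hy _ hq, hy _ (by omega)]), hy _ hq]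
    · intro k
      dsimp only
      have hlt := Nat.mod_lt k hM1
      have hdm := Nat.div_add_mod k M
      by_cases hk : k % M + 1 < M
      · have h1 : (k + 1) / M = k / M := by
          rw [Nat.div_eq_iff (by omega)]
          rw [mul_comm]
          constructor <;> omega
        have h2 : (k + 1) % M = k % M + 1 := by
          have := Nat.div_add_mod (k + 1) M
          rw [h1] at this; omega
        rw [h1, h2]
        exact (hRR (k / M)).2.2.1 _
      · have hk' : k + 1 = M * (k / M + 1) := by rw [mul_add]; omega
        have h1 : (k + 1) / M = k / M + 1 := by
          rw [hk', Nat.mul_div_cancel_left _ (by omega)]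
        have h2 : (k + 1) % M = 0 := by rw [hk', Nat.mul_mod_right]
        have h3 := (hRR (k / M)).2.2.1 (k % M)
        rw [(hRR (k / M)).2.1 (k % M + 1) ((hM _).trans (by omega))] at h3
        rwa [h1, h2, (hRR (k / M + 1)).1]
    · intro k
      exact (hRR (k / M)).2.2.2.1 _
  choose nx hnx using hstep
  let s : ℕ → ℕ × (ℕ → X) := fun n => Nat.rec (1, fun i => if i = 0 then x else y)
    (fun n s => nx n s) n
  have hP : ∀ n, P n (s n) := by
    intro n
    induction n with
    | zero =>
      refine ⟨le_rfl, rfl, fun i hi => ?_, fun i => ?_⟩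
      · have : i ≠ 0 := by change 1 ≤ i at hi; omega
        simp [s, this]
      · by_cases hi : i = 0
        · simpa [s, hi] using hxy
        · simpa [s, hi] using hδ0 0
    | succ n ih => exact (hnx n (s n) ih).1
  have hM := fun n => (hnx n (s n) (hP n)).2
  let F : ℕ → ℝ → X := fun n t => (s n).2 ⌊t * (s n).1⌋₊
  have hF : ∀ t n, dist (F n t) (F (n + 1) t) ≤ r / 2 / 2 ^ n := by
    intro t n
    obtain ⟨M, hM1, hN, hd⟩ := hM n
    have hN' : (s (n + 1)).1 = (s n).1 * M := hN
    have hd' : ∀ k, dist ((s (n + 1)).2 k) ((s n).2 (k / M)) ≤ r / 2 / 2 ^ n := hd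
    have hM0 : (M : ℝ) ≠ 0 := by positivity
    have : ⌊t * (s (n + 1)).1⌋₊ / M = ⌊t * (s n).1⌋₊ := by
      rw [← Nat.floor_div_natCast, hN']
      congr 1
      push_cast
      field_simp
    have h := hd' ⌊t * (s (n + 1)).1⌋₊
    rw [this, dist_comm] at h
    exact h
  have hlim : ∀ t, ∃ a, Tendsto (fun n => F n t) atTop (𝓝 a) := fun t =>
    cauchySeq_tendsto_of_complete (cauchySeq_of_le_geometric_two (hF t))
  choose f hf using hlim
  have hfd : ∀ t n, dist (F n t) (f t) ≤ r / 2 ^ n := fun t n =>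
    dist_le_of_le_geometric_two_of_tendsto (hF t) (hf t) n
  have hFc : ∀ (n : ℕ) (a b : ℝ), 0 ≤ a → a ≤ b → b - a < 1 / (s n).1 → dist (F n a) (F n b) < δ n := by
    intro n a b ha hab h
    have hN : (0 : ℝ) < (s n).1 := by exact_mod_cast (hP n).1
    have h1 : ⌊a * (s n).1⌋₊ ≤ ⌊b * (s n).1⌋₊ := Nat.floor_mono (by gcongr)
    have h2 : ⌊b * (s n).1⌋₊ ≤ ⌊a * (s n).1⌋₊ + 1 := by
      rw [← Nat.floor_add_one (by positivity)]
      apply Nat.floor_mono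
      rw [lt_div_iff₀ hN] at h
      linarith
    rcases (by omega : ⌊b * (s n).1⌋₊ = ⌊a * (s n).1⌋₊ ∨ ⌊b * (s n).1⌋₊ = ⌊a * (s n).1⌋₊ + 1)
      with h3 | h3
    · simp only [F, h3, dist_self]; exact hδ0 n
    · simp only [F, h3]; exact (hP n).2.2.2 _
  have hfc : Continuous fun t : unitInterval => f t := by
    rw [Metric.continuous_iff]
    intro b ε hε
    obtain ⟨n, hn⟩ : ∃ n : ℕ, r * (1 / 2) ^ n < ε / 3 := by
      have h := (tendsto_pow_atTop_nhds_zero_of_lt_one (r := (1 / 2 : ℝ)) (by norm_num)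
        (by norm_num)).const_mul r
      rw [mul_zero] at h
      exact (h.eventually_lt_const (by positivity)).exists
    have hn' : r / 2 ^ n < ε / 3 := by rwa [one_div, inv_pow, ← div_eq_mul_inv] at hn
    have hN : (0 : ℝ) < (s n).1 := by exact_mod_cast (hP n).1
    refine ⟨1 / (s n).1, by positivity, fun a hab => ?_⟩
    have key : dist (F n a) (F n b) < δ n := by
      rw [Subtype.dist_eq, Real.dist_eq, abs_lt] at hab
      rcases le_total (a : ℝ) b with h | h
      · exact hFc n a b a.2.1 h (by linarith)
      · rw [dist_comm]; exact hFc n b a b.2.1 h (by linarith)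
    have h1 := hfd a n
    have h2 := hfd b n
    have h3 : δ n ≤ r / 2 / 2 ^ n := min_le_right _ _
    have h4 : r / 2 / 2 ^ n = (r / 2 ^ n) / 2 := by ring
    have := dist_triangle4 (f a) (F n a) (F n b) (f b)
    rw [dist_comm (f a) (F n a)] at this
    have h5 := hpow n
    linarith
  have hf0 : f 0 = x := by
    refine tendsto_nhds_unique (hf 0) ?_
    have : (fun n => F n 0) = fun _ => x := by
      funext n
      simp only [F, zero_mul, Nat.floor_zero]
      exact (hP n).2.1
    rw [this]; exact tendsto_const_nhds
  have hf1 : f 1 = y := by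
    refine tendsto_nhds_unique (hf 1) ?_
    have : (fun n => F n 1) = fun _ => y := by
      funext n
      simp only [F, one_mul, Nat.floor_natCast]
      exact (hP n).2.2.1 _ le_rfl
    rw [this]; exact tendsto_const_nhds
  refine ⟨⟨⟨fun t => f t, hfc⟩, by simpa using hf0, by simpa using hf1⟩, fun t => ?_⟩
  change dist (f t) x < 3 * r
  have h1 := hfd t 0
  have hδr : δ 0 ≤ r / 2 / 2 ^ 0 := min_le_right _ _
  have h2 : dist (F 0 t) x ≤ r := by
    by_cases h : ⌊(t : ℝ) * (s 0).1⌋₊ = 0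
    · simp only [F, h]
      rw [(hP 0).2.1, dist_self]; exact hr.le
    · have : F 0 t = y := (hP 0).2.2.1 _ (Nat.one_le_iff_ne_zero.2 h)
      rw [this, dist_comm]
      simp at hδr
      linarith
  have := dist_triangle_left (f t) x (F 0 t)
  simp at h1
  linarith

lemma locallyPathConnected [CompactSpace X] [LocallyConnectedSpace X] :
    LocallyPathConnectedSpace X := by
  refine ⟨fun x => ?_⟩
  rw [hasBasis_self]
  intro t ht
  obtain ⟨ε, hε, hεt⟩ := Metric.mem_nhds_iff.1 ht
  obtain ⟨δ, hδ, h⟩ := exists_small_path (X := X) (r := ε / 3) (by positivity)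
  rw [show 3 * (ε / 3) = ε by ring] at h
  refine ⟨pathComponentIn (ball x ε) x, ?_, isPathConnected_pathComponentIn (mem_ball_self hε),
    pathComponentIn_subset.trans hεt⟩
  filter_upwards [ball_mem_nhds x hδ] with y hy
  exact h x y (by rwa [dist_comm])

end PathPart


section ArcPart
open Metric Filter Topology

variable {X : Type*} [MetricSpace X]

def GapSet (γ : ℝ → X) (K : Set ℝ) : Prop :=
  K ⊆ Icc 0 1 ∧ IsClosed K ∧ 0 ∈ K ∧ 1 ∈ K ∧
    ∀ a ∈ K, ∀ b ∈ K, a < b → (∀ u ∈ K, u ≤ a ∨ b ≤ u) → γ a = γ b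

lemma GapSet.remove {γ : ℝ → X} {K : Set ℝ} (hK : GapSet γ K) {s t : ℝ} (hs : s ∈ K) (ht : t ∈ K)
    (hst : s < t) (h : γ s = γ t) : GapSet γ (K \ Ioo s t) := by
  obtain ⟨h1, h2, h3, h4, h5⟩ := hK
  refine ⟨fun x hx => h1 hx.1, h2.sdiff isOpen_Ioo, ⟨h3, fun h => ?_⟩, ⟨h4, fun h => ?_⟩, ?_⟩
  · linarith [h.1, (h1 hs).1]
  · linarith [h.2, (h1 ht).2]
  · rintro a ⟨ha, ha'⟩ b ⟨hb, hb'⟩ hab hg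
    by_cases hc : a ≤ s ∧ t ≤ b
    · have e1 := hg s ⟨hs, fun h => lt_irrefl _ h.1⟩
      have e2 := hg t ⟨ht, fun h => lt_irrefl _ h.2⟩
      have : a = s := by rcases e1 with e | e <;> linarith [hc.1, hc.2]
      have : b = t := by rcases e2 with e | e <;> linarith [hc.1, hc.2]
      subst_vars; exact h
    · apply h5 a ha b hb hab
      intro u hu
      by_contra hcon
      push Not at hcon
      have hu' : u ∈ Ioo s t := by
        by_contra h'
        rcases hg u ⟨hu, h'⟩ with e | e <;> linarith [hcon.1, hcon.2]
      apply hc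
      simp only [mem_Ioo, not_and, not_lt] at ha' hb'
      constructor
      · by_contra h'
        linarith [ha' (by linarith), hcon.1, hu'.2]
      · exact hb' (hu'.1.trans hcon.2)

lemma GapSet.sInter {γ : ℝ → X} (hγ : Continuous γ) {c : Set (Set ℝ)} (hc : ∀ K ∈ c, GapSet γ K)
    (hch : IsChain (· ⊆ ·) c) (hne : c.Nonempty) : GapSet γ (⋂₀ c) := by
  obtain ⟨K₀, hK₀⟩ := hne
  refine ⟨fun x hx => (hc _ hK₀).1 (hx _ hK₀), isClosed_sInter fun K hK => (hc K hK).2.1,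
    fun K hK => (hc K hK).2.2.1, fun K hK => (hc K hK).2.2.2.1, ?_⟩
  intro a ha b hb hab hg
  by_contra hne
  obtain ⟨U, V, hU, hV, haU, hbV, hUV⟩ := t2_separation hne
  obtain ⟨ε, hε, hεU⟩ := Metric.isOpen_iff.1 (hU.preimage hγ) a haU
  obtain ⟨ε', hε', hεV⟩ := Metric.isOpen_iff.1 (hV.preimage hγ) b hbV
  obtain ⟨η, hη, hη1, hη2, hη3⟩ : ∃ η > 0, η < ε ∧ η < ε' ∧ η < (b - a) / 2 := by
    refine ⟨min (min ε ε') ((b - a) / 2) / 2, ?_, ?_, ?_, ?_⟩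
    · have : 0 < min (min ε ε') ((b - a) / 2) := by
        refine lt_min (lt_min hε hε') (by linarith)
      linarith
    all_goals
      have h1 := min_le_left (min ε ε') ((b - a) / 2)
      have h2 := min_le_right (min ε ε') ((b - a) / 2)
      have h3 := min_le_left ε ε'
      have h4 := min_le_right ε ε'
      have : 0 < min (min ε ε') ((b - a) / 2) := by
        refine lt_min (lt_min hε hε') (by linarith)
      linarith
  -- a member avoiding the middle
  obtain ⟨L, hL, hLd⟩ : ∃ L ∈ c, L ⊆ (Icc (a + η) (b - η))ᶜ := by
    have : Nonempty c := ⟨⟨K₀, hK₀⟩⟩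
    obtain ⟨⟨L, hL⟩, h⟩ := exists_subset_nhds_of_isCompact (V := fun K : c => (K : Set ℝ))
      (U := (Icc (a + η) (b - η))ᶜ) (DirectedOn.directed_val (IsChain.directedOn hch.symm))
      (fun K => isCompact_Icc.of_isClosed_subset (hc K K.2).2.1 (hc K K.2).1) (by
        intro x hx
        apply isClosed_Icc.isOpen_compl.mem_nhds
        intro hx'
        rw [← sInter_eq_iInter] at hx
        rcases hg x hx with h | h <;> linarith [hx'.1, hx'.2])
    exact ⟨L, hL, h⟩
  have hLc : IsCompact L := isCompact_Icc.of_isClosed_subset (hc L hL).2.1 (hc L hL).1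
  obtain ⟨a', ⟨ha'L, ha'1⟩, ha'2⟩ := (hLc.inter_right (isClosed_Iic (a := a + η))).exists_isGreatest
    ⟨a, ha L hL, by simp [hη.le]⟩
  obtain ⟨b', ⟨hb'L, hb'1⟩, hb'2⟩ := (hLc.inter_right (isClosed_Ici (a := b - η))).exists_isLeast
    ⟨b, hb L hL, by simp [hη.le]⟩
  have haa' : a ≤ a' := ha'2 ⟨ha L hL, by simp [hη.le]⟩
  have hbb' : b' ≤ b := hb'2 ⟨hb L hL, by simp [hη.le]⟩
  simp only [mem_Iic, mem_Ici] at ha'1 hb'1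
  have heq : γ a' = γ b' := by
    apply (hc L hL).2.2.2.2 a' ha'L b' hb'L (by linarith)
    intro u hu
    have := hLd hu
    simp only [mem_compl_iff, mem_Icc, not_and, not_le] at this
    rcases le_or_gt u (a + η) with h | h
    · exact Or.inl (ha'2 ⟨hu, h⟩)
    · right
      exact hb'2 ⟨hu, (this h.le).le⟩
  have h1 : γ a' ∈ U := hεU (by rw [mem_ball, Real.dist_eq, abs_lt]; constructor <;> linarith)
  have h2 : γ b' ∈ V := hεV (by rw [mem_ball, Real.dist_eq, abs_lt]; constructor <;> linarith)
  exact disjoint_left.1 hUV h1 (heq ▸ h2)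

lemma exists_min_gapSet {γ : ℝ → X} (hγ : Continuous γ) : ∃ K, GapSet γ K ∧
    ∀ s ∈ K, ∀ t ∈ K, s < t → γ s = γ t → ∀ u ∈ K, u ≤ s ∨ t ≤ u := by
  obtain ⟨K, -, hK⟩ := zorn_superset_nonempty {K | GapSet γ K}
    (fun c hc hch hne => ⟨⋂₀ c, GapSet.sInter hγ hc hch hne, fun s hs => sInter_subset_of_mem hs⟩)
    (Icc 0 1) ⟨subset_rfl, isClosed_Icc, by simp, by simp, by
      intro a ha b hb hab h
      exfalso
      rcases h ((a + b) / 2) ⟨by linarith [ha.1, hb.1], by linarith [ha.2, hb.2]⟩ with h | h <;>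
      linarith⟩
  refine ⟨K, hK.prop, fun s hs t ht hst h u hu => ?_⟩
  have := hK.le_of_le (hK.prop.remove hs ht hst h) sdiff_subset hu
  have h2 := this.2
  by_contra hc
  push Not at hc
  exact h2 ⟨hc.1, hc.2⟩

lemma exists_arc [CompactSpace X] {γ : ℝ → X} (hγ : Continuous γ) (hne : γ 0 ≠ γ 1) :
    ∃ α : ℝ → X, Continuous α ∧ InjOn α (Icc 0 1) ∧ α 0 = γ 0 ∧ α 1 = γ 1 ∧
      range α ⊆ γ '' Icc 0 1 := by
  obtain ⟨K, ⟨hK01, hKc, h0, h1, hgap⟩, hmin⟩ := exists_min_gapSet hγ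
  have : Nonempty X := ⟨γ 0⟩
  have hKcpt : IsCompact K := isCompact_Icc.of_isClosed_subset hKc hK01
  have : CompactSpace K := isCompact_iff_compactSpace.1 hKcpt
  let x := TopologicalSpace.denseSeq X
  let A : K → Set X := fun t => γ '' (K ∩ Iic t)
  have hAne : ∀ t, (A t).Nonempty := fun t => ⟨γ t, t, ⟨t.2, self_mem_Iic⟩, rfl⟩
  have hAmono : ∀ s t : K, s ≤ t → A s ⊆ A t := fun s t h =>
    image_mono (inter_subset_inter_right _ (Iic_subset_Iic.2 (show (s : ℝ) ≤ t from h)))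
  have hAc : ∀ t, IsClosed (A t) := fun t =>
    ((hKcpt.inter_right isClosed_Iic).image hγ).isClosed
  let E : ℕ → K → ℝ := fun n t => infDist (x n) (A t)
  have hEanti : ∀ n (s t : K), s ≤ t → E n t ≤ E n s := fun n s t h =>
    infDist_le_infDist_of_subset (hAmono s t h) (hAne s)
  have huc := isCompact_Icc.uniformContinuousOn_of_continuous (hγ.continuousOn (s := Icc (0:ℝ) 1))
  rw [Metric.uniformContinuousOn_iff] at huc
  have hEc : ∀ n, Continuous (E n) := by
    intro n
    have key : ∀ ε > 0, ∃ δ > 0, ∀ s t : K, s ≤ t → dist s t < δ → E n s ≤ E n t + ε := by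
      intro ε hε
      obtain ⟨δ, hδ, h⟩ := huc ε hε
      refine ⟨δ, hδ, fun s t hst hd => ?_⟩
      rw [← sub_le_iff_le_add, le_infDist (hAne t)]
      rintro _ ⟨u, ⟨huK, hut⟩, rfl⟩
      rw [sub_le_iff_le_add]
      rcases le_or_gt u s with hus | hus
      · have := infDist_le_dist_of_mem (x := x n) (show γ u ∈ A s from ⟨u, ⟨huK, hus⟩, rfl⟩)
        linarith
      · have h3 := infDist_le_dist_of_mem (x := x n) (show γ s ∈ A s from ⟨s, ⟨s.2, self_mem_Iic⟩, rfl⟩)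
        have h4 := h u (hK01 huK) s (hK01 s.2) (by
          rw [Subtype.dist_eq, Real.dist_eq, abs_lt] at hd
          rw [Real.dist_eq, abs_lt]
          have : u ≤ t := hut
          constructor <;> linarith)
        have := dist_triangle (x n) (γ u) (γ s)
        change infDist (x n) (A s) ≤ _
        linarith
    rw [Metric.continuous_iff]
    intro b ε hε
    obtain ⟨δ, hδ, h⟩ := key (ε / 2) (half_pos hε)
    refine ⟨δ, hδ, fun a hab => ?_⟩
    rw [Real.dist_eq, abs_lt]
    rcases le_total a b with hle | hle
    · have := h a b hle hab
      have := hEanti n a b hle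
      constructor <;> linarith
    · have := h b a hle (by rwa [dist_comm])
      have := hEanti n b a hle
      constructor <;> linarith
  have hEb : ∀ n t, E n t ≤ diam (univ : Set X) := fun n t => by
    obtain ⟨z, hz⟩ := hAne t
    exact (infDist_le_dist_of_mem hz).trans
      (dist_le_diam_of_mem isCompact_univ.isBounded trivial trivial)
  have hsumb : Summable fun n : ℕ => (1 / 2 : ℝ) ^ n * diam (univ : Set X) :=
    summable_geometric_two.mul_right _
  have hsum : ∀ t, Summable fun n : ℕ => (1 / 2 : ℝ) ^ n * E n t := fun t =>
    hsumb.of_nonneg_of_le (fun n => mul_nonneg (by positivity) infDist_nonneg)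
      (fun n => mul_le_mul_of_nonneg_left (hEb n t) (by positivity))
  let H : K → ℝ := fun t => ∑' n : ℕ, (1 / 2 : ℝ) ^ n * E n t
  have hHc : Continuous H := by
    refine continuous_tsum (fun n => continuous_const.mul (hEc n)) hsumb fun n t => ?_
    rw [Real.norm_of_nonneg (mul_nonneg (by positivity) infDist_nonneg)]
    exact mul_le_mul_of_nonneg_left (hEb n t) (by positivity)
  have hHanti : ∀ s t : K, s ≤ t → H t ≤ H s := fun s t h =>
    (hsum t).tsum_le_tsum (fun n => mul_le_mul_of_nonneg_left (hEanti n s t h) (by positivity))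
      (hsum s)
  have hH1 : ∀ s t : K, s < t → γ s = γ t → H s = H t := by
    intro s t hst h
    have : A s = A t := by
      refine (hAmono s t hst.le).antisymm ?_
      rintro _ ⟨u, ⟨huK, hut⟩, rfl⟩
      rcases hmin s s.2 t t.2 hst h u huK with h' | h'
      · exact ⟨u, ⟨huK, h'⟩, rfl⟩
      · have : u = t := le_antisymm hut h'
        exact ⟨s, ⟨s.2, self_mem_Iic⟩, by rw [h, this]⟩
    simp only [H, E, this]
  have hH2 : ∀ s t : K, s < t → H s = H t → γ s = γ t := by
    intro s t hst h
    by_cases hm : γ t ∈ A s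
    · obtain ⟨u, ⟨huK, hus⟩, hu⟩ := hm
      have hus : u ≤ s := hus
      rcases hmin u huK t t.2 (lt_of_le_of_lt hus hst) hu s s.2 with h' | h'
      · rw [le_antisymm h' hus, hu]
      · exact absurd hst (not_lt.2 h')
    · exfalso
      have hpos : 0 < infDist (γ t) (A s) := ((hAc s).notMem_iff_infDist_pos (hAne s)).1 hm
      obtain ⟨n, hz⟩ := (TopologicalSpace.denseRange_denseSeq X).exists_mem_open
        (isOpen_ball (x := γ t) (ε := infDist (γ t) (A s) / 3)) ⟨γ t, mem_ball_self (by positivity)⟩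
      rw [mem_ball] at hz
      have e1 : E n t ≤ dist (x n) (γ t) :=
        infDist_le_dist_of_mem (show γ t ∈ A t from ⟨t, ⟨t.2, self_mem_Iic⟩, rfl⟩)
      have e2 : infDist (γ t) (A s) ≤ E n s + dist (γ t) (x n) := infDist_le_infDist_add_dist
      rw [dist_comm] at e2
      have e3 : E n t < E n s := by
        change dist (x n) (γ t) < _ at hz
        linarith
      refine absurd h (ne_of_gt ?_)
      exact Summable.tsum_lt_tsum
        (fun n => mul_le_mul_of_nonneg_left (hEanti n s t hst.le) (by positivity))
        (mul_lt_mul_of_pos_left e3 (by positivity)) (hsum t) (hsum s)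
  have hHiff : ∀ s t : K, H s = H t ↔ γ s = γ t := by
    intro s t
    rcases lt_trichotomy s t with h | h | h
    · exact ⟨hH2 s t h, hH1 s t h⟩
    · simp [h]
    · exact ⟨fun e => (hH2 t s h e.symm).symm, fun e => (hH1 t s h e.symm).symm⟩
  let z : K := ⟨0, h0⟩
  let o : K := ⟨1, h1⟩
  have hz : ∀ t : K, z ≤ t := fun t => (hK01 t.2).1
  have ho : ∀ t : K, t ≤ o := fun t => (hK01 t.2).2
  have hoz : H o ≤ H z := hHanti _ _ (hz o)
  let H' : K → Icc (H o) (H z) := fun t => ⟨H t, hHanti _ _ (ho t), hHanti _ _ (hz t)⟩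
  have hH'c : Continuous H' := hHc.subtype_mk _
  have hsurj : Function.Surjective H' := by
    rintro ⟨v, hv1, hv2⟩
    by_contra hcon
    have hcon' : ∀ t, H t ≠ v := fun t ht => hcon ⟨t, Subtype.ext ht⟩
    obtain ⟨s, hs, hs'⟩ := ((isClosed_le continuous_const hHc).isCompact :
      IsCompact {t | v ≤ H t}).exists_isGreatest ⟨z, hv2⟩
    obtain ⟨t, ht, ht'⟩ := ((isClosed_le hHc continuous_const).isCompact :
      IsCompact {t | H t ≤ v}).exists_isLeast ⟨o, hv1⟩
    have hs1 : v < H s := lt_of_le_of_ne hs (hcon' s).symm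
    have ht1 : H t < v := lt_of_le_of_ne ht (hcon' t)
    have hst : s < t := by
      by_contra h
      linarith [hHanti t s (not_lt.1 h)]
    have := hgap s s.2 t t.2 hst (fun u hu => by
      rcases le_total v (H ⟨u, hu⟩) with h | h
      · exact Or.inl (hs' h)
      · exact Or.inr (ht' h))
    have := (hHiff s t).2 this
    linarith
  have hq : IsQuotientMap H' := hH'c.isClosedMap.isQuotientMap hH'c hsurj
  choose k hk using hsurj
  have hkH : ∀ t, γ (k (H' t)) = γ t := fun t => by
    rw [← hHiff]
    exact congrArg Subtype.val (hk (H' t))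
  let α₀ : Icc (H o) (H z) → X := fun v => γ (k v)
  have hα₀ : Continuous α₀ := by
    rw [hq.continuous_iff]
    have : α₀ ∘ H' = fun t : K => γ t := funext hkH
    rw [this]
    exact hγ.comp continuous_subtype_val
  have hα₀i : Function.Injective α₀ := by
    intro v w hvw
    have : H (k v) = H (k w) := (hHiff _ _).2 hvw
    rw [← hk v, ← hk w]
    exact Subtype.ext this
  have hlm : ∀ t ∈ Icc (0:ℝ) 1, AffineMap.lineMap (H z) (H o) t ∈ Icc (H o) (H z) := by
    intro t ht
    rw [AffineMap.lineMap_apply, smul_eq_mul, vsub_eq_sub, vadd_eq_add]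
    constructor <;> nlinarith [ht.1, ht.2]
  have hHne : H o ≠ H z := fun h => hne ((hHiff _ _).1 h).symm
  refine ⟨fun t => IccExtend hoz α₀ (AffineMap.lineMap (H z) (H o) t), ?_, ?_, ?_, ?_, ?_⟩
  · exact hα₀.Icc_extend'.comp AffineMap.lineMap_continuous
  · intro s hs t ht h
    dsimp only at h
    rw [IccExtend_of_mem _ _ (hlm s hs), IccExtend_of_mem _ _ (hlm t ht)] at h
    have := congrArg Subtype.val (hα₀i h)
    exact AffineMap.lineMap_injective ℝ hHne.symm this
  · simp only [AffineMap.lineMap_apply_zero]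
    rw [IccExtend_of_mem _ _ ⟨hoz, le_rfl⟩]
    exact hkH z
  · simp only [AffineMap.lineMap_apply_one]
    rw [IccExtend_of_mem _ _ ⟨le_rfl, hoz⟩]
    exact hkH o
  · rintro _ ⟨t, rfl⟩
    exact ⟨_, hK01 (k _).2, rfl⟩

end ArcPart

section CirclePart
open Metric Filter Topology

lemma exists_circle_s9 {X : Type*} [MetricSpace X] {a b : ℝ → X} (ha : Continuous a)
    (hb : Continuous b) (hai : InjOn a (Icc 0 1)) (hbi : InjOn b (Icc 0 1)) (h0 : a 0 = b 0)
    (h1 : a 1 = b 1)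
    (hab : ∀ x ∈ Icc (0:ℝ) 1, ∀ y ∈ Icc (0:ℝ) 1, a x = b y → x = 0 ∨ x = 1) :
    ∃ S : Set X, Nonempty (S ≃ₜ Circle) := by
  have : Fact ((0:ℝ) < 2) := ⟨by norm_num⟩
  let θ : ℝ → X := fun t => if t ≤ 1 then a t else b (2 - t)
  have hθc : Continuous θ := by
    refine Continuous.if_le ha (hb.comp (by fun_prop)) continuous_id continuous_const ?_
    intro x hx
    rw [hx, h1]; norm_num
  have key : ∀ s t : ℝ, 0 ≤ s → s ≤ 1 → 1 < t → t < 2 → a s ≠ b (2 - t) := by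
    intro s t hs0 hs1 ht1 ht2 h
    have hm : 2 - t ∈ Icc (0:ℝ) 1 := ⟨by linarith, by linarith⟩
    rcases hab s ⟨hs0, hs1⟩ (2 - t) hm h with rfl | rfl
    · have := hbi (by simp) hm (h0 ▸ h); linarith
    · have := hbi (by simp) hm (h1 ▸ h); linarith
  have hθi : InjOn θ (Ico 0 2) := by
    rintro s ⟨hs0, hs2⟩ t ⟨ht0, ht2⟩ h
    simp only [θ] at h
    split_ifs at h with h3 h4 h4
    · exact hai ⟨hs0, h3⟩ ⟨ht0, h4⟩ h
    · exact absurd h (key s t hs0 h3 (not_le.1 h4) ht2)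
    · exact absurd h.symm (key t s ht0 h4 (not_le.1 h3) hs2)
    · have := hbi (x₁ := 2 - s) (x₂ := 2 - t) ⟨by linarith, by linarith⟩
        ⟨by linarith, by linarith⟩ h
      linarith
  let φ : AddCircle (2:ℝ) → X := AddCircle.liftIco 2 0 θ
  have hφc : Continuous φ := by
    refine AddCircle.liftIco_continuous ?_ hθc.continuousOn
    simp [θ, h0]
  have hφi : Function.Injective φ := by
    intro p q hpq
    apply (AddCircle.equivIco (2:ℝ) 0).injective
    have hp : ((AddCircle.equivIco (2:ℝ) 0 p : ℝ)) ∈ Ico (0:ℝ) 2 := by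
      have h := ((AddCircle.equivIco (2:ℝ) 0) p).2
      exact ⟨h.1, by linarith [h.2]⟩
    have hq : ((AddCircle.equivIco (2:ℝ) 0 q : ℝ)) ∈ Ico (0:ℝ) 2 := by
      have h := ((AddCircle.equivIco (2:ℝ) 0) q).2
      exact ⟨h.1, by linarith [h.2]⟩
    exact Subtype.ext (hθi hp hq hpq)
  have hemb : IsEmbedding φ := (hφc.isClosedEmbedding hφi).isEmbedding
  exact ⟨range φ, ⟨hemb.toHomeomorph.symm.trans (AddCircle.homeomorphCircle (by norm_num))⟩⟩

lemma arc_unique {X : Type*} [MetricSpace X] (hno : ¬ ∃ S : Set X, Nonempty (S ≃ₜ Circle))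
    {α β : ℝ → X} (hα : Continuous α) (hβ : Continuous β) (hαi : InjOn α (Icc 0 1))
    (hβi : InjOn β (Icc 0 1)) (h0 : α 0 = β 0) (h1 : α 1 = β 1) :
    α '' Icc 0 1 ⊆ β '' Icc 0 1 := by
  rintro _ ⟨t₀, ht₀, rfl⟩
  by_contra hcon
  apply hno
  have hB : IsClosed (β '' Icc 0 1) := (isCompact_Icc.image hβ).isClosed
  have hC : IsClosed (α ⁻¹' (β '' Icc 0 1)) := hB.preimage hα
  obtain ⟨s, ⟨⟨hs0, hst⟩, hsC⟩, hs⟩ := ((isCompact_Icc (a := (0:ℝ)) (b := t₀)).inter_right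
    hC).exists_isGreatest ⟨0, ⟨le_rfl, ht₀.1⟩, 0, by simp, h0.symm⟩
  obtain ⟨t, ⟨⟨htt, ht1⟩, htC⟩, ht⟩ := ((isCompact_Icc (a := t₀) (b := (1:ℝ))).inter_right
    hC).exists_isLeast ⟨1, ⟨ht₀.2, le_rfl⟩, 1, by simp, h1.symm⟩
  have hst' : s < t₀ := lt_of_le_of_ne hst (by rintro rfl; exact hcon hsC)
  have htt' : t₀ < t := lt_of_le_of_ne htt (by rintro rfl; exact hcon htC)
  obtain ⟨u, hu, hus⟩ := hsC
  obtain ⟨v, hv, hvt⟩ := htC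
  have hne : s ≠ t := (hst'.trans htt').ne
  have huv : u ≠ v := by
    rintro rfl
    have := hαi ⟨hs0, by linarith [ht₀.2]⟩ ⟨by linarith [ht₀.1], ht1⟩ (hus.symm.trans hvt)
    exact hne this
  have hmem : ∀ {p q : ℝ}, p ∈ Icc (0:ℝ) 1 → q ∈ Icc (0:ℝ) 1 → ∀ x ∈ Icc (0:ℝ) 1,
      AffineMap.lineMap p q x ∈ Icc (0:ℝ) 1 := by
    intro p q hp hq x hx
    exact (convex_Icc (0:ℝ) 1).lineMap_mem hp hq hx
  have hs01 : s ∈ Icc (0:ℝ) 1 := ⟨hs0, by linarith [ht₀.2]⟩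
  have ht01 : t ∈ Icc (0:ℝ) 1 := ⟨by linarith [ht₀.1], ht1⟩
  refine exists_circle_s9 (a := fun x => α (AffineMap.lineMap s t x))
    (b := fun x => β (AffineMap.lineMap u v x))
    (hα.comp AffineMap.lineMap_continuous) (hβ.comp AffineMap.lineMap_continuous) ?_ ?_ ?_ ?_ ?_
  · intro x hx y hy h
    exact AffineMap.lineMap_injective ℝ hne (hαi (hmem hs01 ht01 x hx) (hmem hs01 ht01 y hy) h)
  · intro x hx y hy h
    exact AffineMap.lineMap_injective ℝ huv (hβi (hmem hu hv x hx) (hmem hu hv y hy) h)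
  · simp [hus]
  · simp [hvt]
  · intro x hx y hy h
    have hp := hmem hs01 ht01 x hx
    have hpC : AffineMap.lineMap s t x ∈ α ⁻¹' (β '' Icc 0 1) := ⟨_, hmem hu hv y hy, h.symm⟩
    have hpe : AffineMap.lineMap s t x = s + x * (t - s) := by
      rw [AffineMap.lineMap_apply, smul_eq_mul, vsub_eq_sub, vadd_eq_add, add_comm]
    have hts : 0 < t - s := by linarith
    rcases le_total (AffineMap.lineMap s t x) t₀ with h' | h'
    · left
      have := hs ⟨⟨hp.1, h'⟩, hpC⟩
      rw [hpe] at this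
      nlinarith [hx.1]
    · right
      have := ht ⟨⟨h', hp.2⟩, hpC⟩
      rw [hpe] at this
      nlinarith [hx.2]

lemma split_of_not_preconnected {X : Type*} [TopologicalSpace X] [NormalSpace X] {S : Set X}
    (hS : IsClosed S) (h : ¬ IsPreconnected S) : ∃ U V : Set X, IsOpen U ∧ IsOpen V ∧ Disjoint U V ∧
      S ⊆ U ∪ V ∧ (S ∩ U).Nonempty ∧ (S ∩ V).Nonempty := by
  rw [isPreconnected_closed_iff] at h
  push Not at h
  obtain ⟨t, t', ht, ht', hc, ⟨p, hpS, hpt⟩, ⟨q, hqS, hqt⟩, he⟩ := h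
  obtain ⟨U, V, hU, hV, hSU, hSV, hd⟩ := normal_separation (hS.inter ht) (hS.inter ht') (by
    rw [disjoint_left]
    rintro x ⟨hx, hxt⟩ ⟨_, hxt'⟩
    have : x ∈ S ∩ (t ∩ t') := ⟨hx, hxt, hxt'⟩
    rw [he] at this
    exact this)
  refine ⟨U, V, hU, hV, hd, ?_, ⟨p, hpS, hSU ⟨hpS, hpt⟩⟩, ⟨q, hqS, hSV ⟨hqS, hqt⟩⟩⟩
  intro x hx
  exact (hc hx).imp (fun h => hSU ⟨hx, h⟩) (fun h => hSV ⟨hx, h⟩)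

lemma exists_arc_in_s9 {X : Type*} [MetricSpace X] [CompactSpace X] [LocallyConnectedSpace X]
    {A O : Set X} (hA : IsPreconnected A) (hO : IsOpen O) (hAO : A ⊆ O) {p q : X} (hp : p ∈ A)
    (hq : q ∈ A) (hpq : p ≠ q) :
    ∃ α : ℝ → X, Continuous α ∧ InjOn α (Icc 0 1) ∧ α 0 = p ∧ α 1 = q ∧ range α ⊆ O := by
  have : LocallyPathConnectedSpace X := locallyPathConnected
  have hU : IsOpen (connectedComponentIn O p) := hO.connectedComponentIn
  have hUc : IsConnected (connectedComponentIn O p) := isConnected_connectedComponentIn_iff.2 (hAO hp)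
  have hsub := hA.subset_connectedComponentIn hp hAO
  have hpath := hU.isConnected_iff_isPathConnected.1 hUc
  obtain ⟨γ, hγ⟩ := hpath.joinedIn p (hsub hp) q (hsub hq)
  obtain ⟨α, h1, h2, h3, h4, h5⟩ := exists_arc (γ := γ.extend) γ.continuous_extend (by simpa using hpq)
  refine ⟨α, h1, h2, by simpa using h3, by simpa using h4, ?_⟩
  refine h5.trans ?_
  rintro _ ⟨t, ht, rfl⟩
  rw [γ.extend_apply ht]
  exact connectedComponentIn_subset _ _ (hγ _)

lemma unicoherent {X : Type*} [MetricSpace X] [CompactSpace X] [LocallyConnectedSpace X]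
    (hno : ¬ ∃ S : Set X, Nonempty (S ≃ₜ Circle)) {A B : Set X} (hA : IsClosed A) (hB : IsClosed B)
    (hAc : IsPreconnected A) (hBc : IsPreconnected B) : IsPreconnected (A ∩ B) := by
  by_contra hcon
  obtain ⟨U, V, hU, hV, hd, hc, ⟨p, hp, hpU⟩, ⟨q, hq, hqV⟩⟩ :=
    split_of_not_preconnected (hA.inter hB) hcon
  have hpq : p ≠ q := by
    rintro rfl
    exact disjoint_left.1 hd hpU hqV
  have hW := hU.union hV
  obtain ⟨O₁, O₂, hO₁, hO₂, hAO, hBO, hOd⟩ := normal_separation (hA.sdiff hW) (hB.sdiff hW) (by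
    rw [disjoint_left]
    rintro x ⟨hx, hxt⟩ ⟨hx', _⟩
    exact hxt (hc ⟨hx, hx'⟩))
  obtain ⟨α, hα, hαi, hα0, hα1, hαO⟩ := exists_arc_in_s9 (O := O₁ ∪ (U ∪ V)) hAc (hO₁.union hW)
    (fun x hx => by
      by_cases h : x ∈ U ∪ V
      · exact Or.inr h
      · exact Or.inl (hAO ⟨hx, h⟩)) hp.1 hq.1 hpq
  obtain ⟨β, hβ, hβi, hβ0, hβ1, hβO⟩ := exists_arc_in_s9 (O := O₂ ∪ (U ∪ V)) hBc (hO₂.union hW)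
    (fun x hx => by
      by_cases h : x ∈ U ∪ V
      · exact Or.inr h
      · exact Or.inl (hBO ⟨hx, h⟩)) hp.2 hq.2 hpq
  have hsub := arc_unique hno hα hβ hαi hβi (hα0.trans hβ0.symm) (hα1.trans hβ1.symm)
  have hin : α '' Icc 0 1 ⊆ U ∪ V := by
    intro x hx
    obtain ⟨y, hy, hyx⟩ := hsub hx
    rcases hαO (image_subset_range _ _ hx) with h | h
    · rcases hβO ⟨y, hyx⟩ with h' | h'
      · exact absurd h' (disjoint_left.1 hOd h)
      · exact h'
    · exact h
  obtain ⟨x, -, hxU, hxV⟩ := (isPreconnected_Icc.image α hα.continuousOn) U V hU hV hin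
    ⟨p, ⟨0, by simp, hα0⟩, hpU⟩ ⟨q, ⟨1, by simp, hα1⟩, hqV⟩
  exact disjoint_left.1 hd hxU hxV

lemma helly {X ι : Type*} [MetricSpace X] [CompactSpace X] [LocallyConnectedSpace X]
    (hno : ¬ ∃ S : Set X, Nonempty (S ≃ₜ Circle)) [Nonempty ι] (Z : ι → Set X)
    (hcl : ∀ i, IsClosed (Z i))
    (hco : ∀ i, IsPreconnected (Z i)) (hpw : ∀ i j, (Z i ∩ Z j).Nonempty) :
    (⋂ i, Z i).Nonempty ∧ IsPreconnected (⋂ i, Z i) := by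
  classical
  have h3 : ∀ A B C : Set X, IsClosed A → IsClosed B → IsClosed C → IsPreconnected A →
      IsPreconnected B → IsPreconnected C → (A ∩ B).Nonempty → (A ∩ C).Nonempty →
      (B ∩ C).Nonempty → ((A ∩ B) ∩ C).Nonempty := by
    intro A B C hA hB hC cA cB cC hAB hAC ⟨x, hxB, hxC⟩
    have hu : IsPreconnected (B ∪ C) := cB.union x hxB hxC cC
    have hi := unicoherent hno hA (hB.union hC) cA hu
    rw [isPreconnected_closed_iff] at hi
    obtain ⟨y, ⟨hyA, -⟩, hyB, hyC⟩ := hi B C hB hC inter_subset_right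
      (by obtain ⟨y, h1, h2⟩ := hAB; exact ⟨y, ⟨h1, Or.inl h2⟩, h2⟩)
      (by obtain ⟨y, h1, h2⟩ := hAC; exact ⟨y, ⟨h1, Or.inr h2⟩, h2⟩)
    exact ⟨y, ⟨hyA, hyB⟩, hyC⟩
  have hfin : ∀ (s : Finset ι) (C : Set X), IsClosed C → IsPreconnected C → C.Nonempty →
      (∀ i, (C ∩ Z i).Nonempty) → (C ∩ ⋂ i ∈ s, Z i).Nonempty ∧
        IsPreconnected (C ∩ ⋂ i ∈ s, Z i) := by
    intro s
    induction s using Finset.induction_on with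
    | empty => intro C _ h2 h _; simpa using ⟨h, h2⟩
    | insert j s _ ih =>
      intro C hC hCc hne hCi
      have := ih (C ∩ Z j) (hC.inter (hcl j)) (unicoherent hno hC (hcl j) hCc (hco j)) (hCi j)
        (fun i => h3 C (Z j) (Z i) hC (hcl j) (hcl i) hCc (hco j) (hco i) (hCi j) (hCi i) (hpw j i))
      simpa [inter_assoc] using this
  obtain ⟨i₀⟩ := ‹Nonempty ι›
  let T : Finset ι → Set X := fun s => Z i₀ ∩ ⋂ i ∈ s, Z i
  have hT := fun s => hfin s (Z i₀) (hcl i₀) (hco i₀) (by simpa using hpw i₀ i₀) (hpw i₀)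
  have hTcl : ∀ s, IsClosed (T s) := fun s =>
    (hcl i₀).inter (isClosed_biInter fun i _ => hcl i)
  have hTd : Directed (· ⊇ ·) T := by
    apply directed_of_isDirected_le
    intro s t hst
    exact inter_subset_inter_right _ (biInter_subset_biInter_left hst)
  have hTe : ⋂ s, T s = ⋂ i, Z i := by
    ext x
    simp only [T, mem_iInter, mem_inter_iff]
    exact ⟨fun h i => (h {i}).2 i (by simp), fun h s => ⟨h i₀, fun i _ => h i⟩⟩
  rw [← hTe]
  refine ⟨IsCompact.nonempty_iInter_of_directed_nonempty_isCompact_isClosed T hTd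
    (fun s => (hT s).1) (fun s => (hTcl s).isCompact) hTcl, ?_⟩
  by_contra hcon
  obtain ⟨U, V, hU, hV, hd, hc, ⟨p, hp, hpU⟩, ⟨q, hq, hqV⟩⟩ :=
    split_of_not_preconnected (isClosed_iInter hTcl) hcon
  obtain ⟨s, hs⟩ := exists_subset_nhds_of_isCompact hTd (fun s => (hTcl s).isCompact)
    (U := U ∪ V) (fun x hx => (hU.union hV).mem_nhds (hc hx))
  obtain ⟨x, -, hxU, hxV⟩ := (hT s).2 U V hU hV hs ⟨p, mem_iInter.1 hp s, hpU⟩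
    ⟨q, mem_iInter.1 hq s, hqV⟩
  exact disjoint_left.1 hd hxU hxV

end CirclePart

theorem dendroMinimal_disjoint_translate (G X : Type*) [Group G] [TopologicalSpace X]
    [MulAction G X] (hcont : ∀ g : G, Continuous fun x : X => g • x)
    (hX : IsDendrite X) (hmin : DendroMinimal G X)
    (Y : Set X) (hYne : Y.Nonempty) (hYcl : IsClosed Y) (hYconn : IsPreconnected Y)
    (hYproper : Y ≠ univ) :
    ∃ g : G, ((g • ·) '' Y) ∩ Y = ∅ := by
  obtain ⟨-, hcpt, -, hmet, hlc, hno⟩ := hX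
  letI : MetricSpace X := TopologicalSpace.metrizableSpaceMetric X
  by_contra hcon
  push Not at hcon
  let Z : G → Set X := fun g => (g • ·) '' Y
  have hZ : ∀ g x, x ∈ Z g ↔ g⁻¹ • x ∈ Y := by
    intro g x
    constructor
    · rintro ⟨y, hy, rfl⟩
      simpa using hy
    · intro h
      exact ⟨_, h, by simp⟩
  obtain ⟨hne, hpc⟩ := helly hno Z (fun g => (hYcl.isCompact.image (hcont g)).isClosed)
    (fun g => hYconn.image _ (hcont g).continuousOn) (fun g h => by
      obtain ⟨x, hx, hxY⟩ := hcon (h⁻¹ * g)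
      have hx' := (hZ (h⁻¹ * g) x).1 hx
      refine ⟨h • x, (hZ _ _).2 ?_, (hZ _ _).2 ?_⟩
      · simpa [mul_smul] using hx'
      · simpa using hxY)
  have huniv := hmin (⋂ g, Z g) hne
    (isClosed_iInter fun g => (hYcl.isCompact.image (hcont g)).isClosed) hpc (by
      intro g
      ext x
      simp only [mem_image, mem_iInter, hZ]
      constructor
      · rintro ⟨y, hy, rfl⟩ h
        have := hy (g⁻¹ * h)
        simpa [mul_smul] using this
      · intro h
        refine ⟨g⁻¹ • x, fun k => ?_, by simp⟩
        have := h (g * k)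
        simpa [mul_smul] using this)
  apply hYproper
  rw [eq_univ_iff_forall] at huniv ⊢
  intro x
  have := (hZ 1 x).1 (mem_iInter.1 (huniv x) 1)
  simpa using this
end

section
/- Let G be a group acting dendro-minimally by homeomorphisms on a dendrite X. Then for every x ∈ X, the closure of the orbit Gx contains all end points of X. -/
open Set

theorem dm_small {X : Type*} [MetricSpace X] [LocallyConnectedSpace X] {U : Set X} (hU : IsOpen U)
    {x : X} (hx : x ∈ U) {ε : ℝ} (hε : 0 < ε) :
    ∃ V : Set X, IsOpen V ∧ IsPreconnected V ∧ x ∈ V ∧ closure V ⊆ U ∧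
      ∀ y ∈ V, ∀ z ∈ V, dist y z ≤ ε := by
  obtain ⟨r, hr, hrU⟩ := Metric.nhds_basis_closedBall.mem_iff.1 (hU.mem_nhds hx)
  set s := min r (ε / 2) with hs
  have hs0 : 0 < s := lt_min hr (by positivity)
  refine ⟨connectedComponentIn (Metric.ball x s) x, Metric.isOpen_ball.connectedComponentIn,
    isPreconnected_connectedComponentIn, mem_connectedComponentIn (Metric.mem_ball_self hs0), ?_, ?_⟩
  · refine subset_trans (closure_mono (connectedComponentIn_subset _ _)) ?_
    refine subset_trans Metric.closure_ball_subset_closedBall ?_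
    exact subset_trans (Metric.closedBall_subset_closedBall (min_le_left _ _)) hrU
  · intro y hy z hz
    have h1 := Metric.mem_ball.1 (connectedComponentIn_subset _ _ hy)
    have h2 := Metric.mem_ball.1 (connectedComponentIn_subset _ _ hz)
    have h3 := dist_triangle_right y z x
    have h4 : s ≤ ε / 2 := min_le_right _ _
    linarith

/-- a finite chain of small open connected sets from a to b in U -/
def DMChain {X : Type*} [MetricSpace X] (U : Set X) (ε : ℝ) (a b : X) (N : ℕ) (p : ℕ → X)
    (V : ℕ → Set X) : Prop :=
  p 0 = a ∧ (∀ i ≥ N, p i = b) ∧ ∀ i, IsOpen (V i) ∧ IsPreconnected (V i) ∧ p i ∈ V i ∧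
    p (i + 1) ∈ V i ∧ closure (V i) ⊆ U ∧ ∀ y ∈ V i, ∀ z ∈ V i, dist y z ≤ ε

theorem dm_chain_refl {X : Type*} [MetricSpace X] [LocallyConnectedSpace X] {U : Set X}
    (hU : IsOpen U) {x : X} (hx : x ∈ U) {ε : ℝ} (hε : 0 < ε) :
    ∃ p V, DMChain U ε x x 0 p V := by
  obtain ⟨V, h1, h2, h3, h4, h5⟩ := dm_small hU hx hε
  exact ⟨fun _ => x, fun _ => V, rfl, fun _ _ => rfl, fun _ => ⟨h1, h2, h3, h3, h4, h5⟩⟩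

theorem dm_chain {X : Type*} [MetricSpace X] [LocallyConnectedSpace X] {U : Set X}
    (hU : IsOpen U) (hc : IsPreconnected U) {a b : X} (ha : a ∈ U) (hb : b ∈ U) {ε : ℝ}
    (hε : 0 < ε) : ∃ N p V, DMChain U ε a b N p V := by
  let R : X → X → Prop := fun x y => ∃ V : Set X, IsOpen V ∧ IsPreconnected V ∧ x ∈ V ∧ y ∈ V ∧
    closure V ⊆ U ∧ ∀ y ∈ V, ∀ z ∈ V, dist y z ≤ ε
  have hRs : ∀ x y, R x y → R y x := fun x y ⟨V, h1, h2, h3, h4, h5, h6⟩ =>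
    ⟨V, h1, h2, h4, h3, h5, h6⟩
  have key : Relation.ReflTransGen R a b := by
    refine hc.induction₂ (Relation.ReflTransGen R) ?_ ?_ ?_ ha hb
    · intro x hx
      obtain ⟨V, h1, h2, h3, h4, h5⟩ := dm_small hU hx hε
      filter_upwards [mem_nhdsWithin_of_mem_nhds (h1.mem_nhds h3)] with y hy
      exact Relation.ReflTransGen.single ⟨V, h1, h2, h3, hy, h4, h5⟩
    · intro x y z _ _ _ h1 h2
      exact h1.trans h2
    · intro x y _ _ h
      have : Std.Symm R := ⟨hRs⟩
      exact Relation.ReflTransGen.stdSymm.symm _ _ h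
  induction key using Relation.ReflTransGen.head_induction_on with
  | refl =>
    obtain ⟨p, V, h⟩ := dm_chain_refl hU hb hε
    exact ⟨0, p, V, h⟩
  | head h1 h2 ih =>
    rename_i x y
    obtain ⟨W, w1, w2, w3, w4, w5, w6⟩ := h1
    obtain ⟨N, p, V, h0, hN, hV⟩ := ih (w5 (subset_closure w4))
    refine ⟨N + 1, fun i => Nat.casesOn i x p, fun i => Nat.casesOn i W V, rfl, ?_, ?_⟩
    · intro i hi
      cases i with
      | zero => omega
      | succ i => exact hN i (by omega)
    · intro i
      cases i with
      | zero => exact ⟨w1, w2, w3, by simpa [h0] using w4, w5, w6⟩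
      | succ i => exact hV i

structure DMLev {X : Type*} [MetricSpace X] (a b : X) where
  K : ℕ
  p : ℕ → X
  V : ℕ → Set X
  hK : 0 < K
  p0 : p 0 = a
  pK : ∀ i ≥ K, p i = b
  op : ∀ i, IsOpen (V i)
  conn : ∀ i, IsPreconnected (V i)
  mem : ∀ i, p i ∈ V i
  mem' : ∀ i, p (i + 1) ∈ V i

theorem dm_step {X : Type*} [MetricSpace X] [LocallyConnectedSpace X] {a b : X} (L : DMLev a b)
    {ε : ℝ} (hε : 0 < ε) : ∃ (L' : DMLev a b) (k : ℕ), 0 < k ∧ L'.K = L.K * k ∧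
      (∀ j, closure (L'.V j) ⊆ L.V (j / k)) ∧ ∀ j, ∀ y ∈ L'.V j, ∀ z ∈ L'.V j, dist y z ≤ ε := by
  have key : ∀ i, ∃ N p V, DMChain (L.V i) ε (L.p i) (L.p (i + 1)) N p V ∧ (L.K ≤ i → N = 0) := by
    intro i
    by_cases h : L.K ≤ i
    · have h1 := L.pK i h
      have h2 := L.pK (i + 1) (by omega)
      obtain ⟨p, V, hh⟩ := dm_chain_refl (L.op i) (L.mem i) hε
      refine ⟨0, p, V, ?_, fun _ => rfl⟩
      rw [h2]; rw [h1] at hh ⊢; exact hh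
    · obtain ⟨N, p, V, hh⟩ := dm_chain (L.op i) (L.conn i) (L.mem i) (L.mem' i) hε
      exact ⟨N, p, V, hh, fun h' => absurd h' h⟩
  choose N q W hW hN using key
  set k := (Finset.range L.K).sup N + 1 with hk
  have hNk : ∀ i, N i ≤ k := by
    intro i
    by_cases h : L.K ≤ i
    · rw [hN i h]; omega
    · have := Finset.le_sup (f := N) (Finset.mem_range.2 (not_le.1 h))
      omega
  have hk0 : 0 < k := by omega
  refine ⟨{ K := L.K * k, p := fun j => q (j / k) (j % k), V := fun j => W (j / k) (j % k),
            hK := Nat.mul_pos L.hK hk0, p0 := ?_, pK := ?_, op := ?_, conn := ?_, mem := ?_,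
            mem' := ?_ }, k, hk0, rfl, ?_, ?_⟩
  · simp [(hW 0).1, L.p0]
  · intro j hj
    have h1 : L.K ≤ j / k := (Nat.le_div_iff_mul_le hk0).2 hj
    rw [(hW (j / k)).2.1 _ (by rw [hN _ h1]; omega)]
    exact L.pK _ (by omega)
  · exact fun j => ((hW _).2.2 _).1
  · exact fun j => ((hW _).2.2 _).2.1
  · exact fun j => ((hW _).2.2 _).2.2.1
  · intro j
    have h := ((hW (j / k)).2.2 (j % k)).2.2.2.1
    have hlt := Nat.mod_lt j hk0
    have hdm := Nat.div_add_mod j k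
    by_cases h1 : j % k + 1 < k
    · have e1 : (j + 1) / k = j / k := by
        rw [Nat.div_eq_iff hk0, mul_comm (j / k) k]; constructor <;> omega
      have e2 : (j + 1) % k = j % k + 1 := by
        have := Nat.div_add_mod (j + 1) k
        rw [e1] at this; omega
      simp only [e1, e2]; exact h
    · have h2 : j % k + 1 = k := by omega
      have e0 : j + 1 = k * (j / k + 1) := by rw [mul_add]; omega
      have e1 : (j + 1) / k = j / k + 1 := by rw [e0]; exact Nat.mul_div_cancel_left _ hk0
      have e2 : (j + 1) % k = 0 := by rw [e0]; exact Nat.mul_mod_right _ _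
      simp only [e1, e2]
      rw [(hW (j / k + 1)).1]
      rw [h2, (hW (j / k)).2.1 k (hNk _)] at h
      exact h
  · exact fun j => ((hW _).2.2 _).2.2.2.2.1
  · exact fun j => ((hW _).2.2 _).2.2.2.2.2

theorem dm_path {X : Type*} [MetricSpace X] [CompactSpace X] [LocallyConnectedSpace X] {U : Set X}
    (hU : IsOpen U) (hc : IsPreconnected U) {a b : X} (ha : a ∈ U) (hb : b ∈ U) :
    ∃ f : ℝ → X, Continuous f ∧ (∀ t ≤ 0, f t = a) ∧ (∀ t ≥ 1, f t = b) ∧ ∀ t, f t ∈ U := by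
  let L0 : DMLev a b :=
    { K := 1, p := fun i => if i = 0 then a else b, V := fun _ => U, hK := one_pos, p0 := rfl,
      pK := fun i hi => if_neg (by omega), op := fun _ => hU, conn := fun _ => hc,
      mem := fun i => by split_ifs <;> assumption,
      mem' := fun i => by split_ifs <;> assumption }
  have hst : ∀ (n : ℕ) (L : DMLev a b), ∃ (L' : DMLev a b) (k : ℕ), 0 < k ∧ L'.K = L.K * k ∧
      (∀ j, closure (L'.V j) ⊆ L.V (j / k)) ∧
      ∀ j, ∀ y ∈ L'.V j, ∀ z ∈ L'.V j, dist y z ≤ (1 / 2 : ℝ) ^ n :=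
    fun n L => dm_step L (by positivity)
  choose S k hk hSK hSV hSd using hst
  let L : ℕ → DMLev a b := fun n => Nat.rec L0 (fun n l => S n l) n
  let I : ℕ → ℝ → ℕ := fun n t => ⌊t * (L n).K⌋₊
  have hI : ∀ n t, I (n + 1) t / k n (L n) = I n t := by
    intro n t
    have hk' : ((k n (L n) : ℕ) : ℝ) ≠ 0 := by exact_mod_cast (hk n (L n)).ne'
    have e : (L (n + 1)).K = (L n).K * k n (L n) := hSK n (L n)
    simp only [I]
    rw [← Nat.floor_div_natCast, e]
    congr 1
    push_cast
    field_simp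
  have hsub : ∀ n t, closure ((L (n + 1)).V (I (n + 1) t)) ⊆ (L n).V (I n t) := by
    intro n t
    have := hSV n (L n) (I (n + 1) t)
    rw [hI] at this
    exact this
  have hne : ∀ t, (⋂ n, closure ((L n).V (I n t))).Nonempty := by
    intro t
    refine IsCompact.nonempty_iInter_of_sequence_nonempty_isCompact_isClosed _ ?_ ?_ ?_ ?_
    · exact fun n => (hsub n t).trans subset_closure
    · exact fun n => ⟨_, subset_closure ((L n).mem _)⟩
    · exact isClosed_closure.isCompact
    · exact fun _ => isClosed_closure
  choose f hf using hne
  have hfV : ∀ n t, f t ∈ (L n).V (I n t) := fun n t => hsub n t (mem_iInter.1 (hf t) (n + 1))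
  have hd : ∀ n j, ∀ y ∈ (L (n + 1)).V j, ∀ z ∈ (L (n + 1)).V j, dist y z ≤ (1 / 2 : ℝ) ^ n :=
    fun n j => hSd n (L n) j
  have heq : ∀ x y : X, (∀ n : ℕ, dist x y ≤ (1 / 2 : ℝ) ^ n) → x = y := by
    intro x y h
    refine dist_le_zero.1 (ge_of_tendsto'
      (tendsto_pow_atTop_nhds_zero_of_lt_one (by norm_num) (by norm_num) : Filter.Tendsto (fun n : ℕ => (1 / 2 : ℝ) ^ n) _ _) h)
  refine ⟨f, ?_, ?_, ?_, fun t => hfV 0 t⟩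
  · rw [Metric.continuous_iff]
    intro t ε hε
    obtain ⟨n, hn⟩ := exists_pow_lt_of_lt_one (show 0 < ε / 2 by positivity)
      (show (1 / 2 : ℝ) < 1 by norm_num)
    have hKp : (0 : ℝ) < (L (n + 1)).K := by exact_mod_cast (L (n + 1)).hK
    refine ⟨1 / (L (n + 1)).K, by positivity, ?_⟩
    have main : ∀ s t : ℝ, s ≤ t → t - s < 1 / (L (n + 1)).K → dist (f s) (f t) < ε := by
      intro s t hst h
      have h1 : t * (L (n + 1)).K ≤ s * (L (n + 1)).K + 1 := by
        rw [lt_div_iff₀ hKp] at h; linarith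
      have h2 : s * (L (n + 1)).K ≤ t * (L (n + 1)).K := by gcongr
      have h3 : I (n + 1) s ≤ I (n + 1) t := Nat.floor_mono h2
      have h4 : I (n + 1) t ≤ I (n + 1) s + 1 := by
        have : I (n + 1) t < I (n + 1) s + 2 := by
          simp only [I]
          rw [Nat.floor_lt' (by omega)]
          have := Nat.lt_floor_add_one (s * (L (n + 1)).K)
          push_cast; linarith
        omega
      have hc : ∃ c, c ∈ (L (n + 1)).V (I (n + 1) s) ∧ c ∈ (L (n + 1)).V (I (n + 1) t) := by
        rcases Nat.lt_or_ge (I (n + 1) s) (I (n + 1) t) with h5 | h5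
        · have : I (n + 1) t = I (n + 1) s + 1 := by omega
          rw [this]
          exact ⟨_, (L (n + 1)).mem' _, (L (n + 1)).mem _⟩
        · rw [le_antisymm h3 h5]
          exact ⟨_, (L (n + 1)).mem _, (L (n + 1)).mem _⟩
      obtain ⟨c, c1, c2⟩ := hc
      have d1 := hd n _ _ (hfV (n + 1) s) _ c1
      have d2 := hd n _ _ c2 _ (hfV (n + 1) t)
      have := dist_triangle (f s) c (f t)
      linarith
    intro s hs
    rw [Real.dist_eq, abs_lt] at hs
    rcases le_total s t with h | h
    · exact main s t h (by linarith)
    · rw [dist_comm]; exact main t s h (by linarith)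
  · intro t ht
    refine heq _ _ fun n => hd n _ _ (hfV (n + 1) t) _ ?_
    have : I (n + 1) t = 0 := Nat.floor_of_nonpos (mul_nonpos_of_nonpos_of_nonneg ht (by positivity))
    rw [this]
    have := (L (n + 1)).mem 0
    rwa [(L (n + 1)).p0] at this
  · intro t ht
    refine heq _ _ fun n => hd n _ _ (hfV (n + 1) t) _ ?_
    have : (L (n + 1)).K ≤ I (n + 1) t := by
      refine Nat.le_floor ?_
      have : (0 : ℝ) ≤ (L (n + 1)).K := by positivity
      nlinarith
    have h2 := (L (n + 1)).mem (I (n + 1) t)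
    rwa [(L (n + 1)).pK _ this] at h2

def DMGood {X : Type*} (f : ℝ → X) (M : Set ℝ) : Prop :=
  IsClosed M ∧ Iic 0 ⊆ M ∧ Ici 1 ⊆ M ∧
    ∀ s ∈ M, ∀ t ∈ M, s < t → (∀ x ∈ M, s < x → x < t → False) → f s = f t

theorem dm_sigma {M : Set ℝ} (h : IsClosed M) (h0 : Iic 0 ⊆ M) (u : ℝ) :
    ∃ s, IsGreatest (M ∩ Iic u) s := by
  refine ⟨_, IsClosed.isGreatest_csSup (h.inter isClosed_Iic) ?_ ?_⟩
  · exact ⟨min u 0, h0 (mem_Iic.2 (min_le_right _ _)), mem_Iic.2 (min_le_left _ _)⟩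
  · exact ⟨u, fun x hx => hx.2⟩

theorem dm_tau {M : Set ℝ} (h : IsClosed M) (h0 : Ici 1 ⊆ M) (u : ℝ) :
    ∃ s, IsLeast (M ∩ Ici u) s := by
  refine ⟨_, IsClosed.isLeast_csInf (h.inter isClosed_Ici) ?_ ?_⟩
  · exact ⟨max u 1, h0 (mem_Ici.2 (le_max_right _ _)), mem_Ici.2 (le_max_left _ _)⟩
  · exact ⟨u, fun x hx => hx.2⟩

theorem dm_minimal {X : Type*} [MetricSpace X] (f : ℝ → X) (hf : Continuous f) :
    ∃ M, Minimal (fun M => M ∈ {M | DMGood f M}) M := by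
  have hu : (univ : Set ℝ) ∈ {M | DMGood f M} := by
    refine ⟨isClosed_univ, subset_univ _, subset_univ _, ?_⟩
    intro s _ t _ hst h
    obtain ⟨x, h1, h2⟩ := exists_between hst
    exact (h x trivial h1 h2).elim
  obtain ⟨M, _, hM⟩ := zorn_superset_nonempty {M | DMGood f M} (by
    intro c hc hch hne
    refine ⟨⋂₀ c, ⟨isClosed_sInter fun m hm => (hc hm).1, subset_sInter fun m hm => (hc hm).2.1,
      subset_sInter fun m hm => (hc hm).2.2.1, ?_⟩, fun s hs => sInter_subset_of_mem hs⟩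
    intro s hs t ht hst hgap
    by_contra hne'
    set e := dist (f s) (f t) with he
    have he0 : 0 < e := dist_pos.2 hne'
    obtain ⟨d1, hd1, h1⟩ := Metric.continuous_iff.1 hf s (e / 2) (by positivity)
    obtain ⟨d2, hd2, h2⟩ := Metric.continuous_iff.1 hf t (e / 2) (by positivity)
    obtain ⟨η, hη0, hη1, hη2, hη3⟩ : ∃ η > 0, η < d1 ∧ η < d2 ∧ η < (t - s) / 2 := by
      have : 0 < min d1 (min d2 ((t - s) / 2)) :=
        lt_min hd1 (lt_min hd2 (by linarith))
      obtain ⟨η, h3, h4⟩ := exists_between this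
      simp only [lt_min_iff] at h4
      exact ⟨η, h3, h4.1, h4.2.1, h4.2.2⟩
    obtain ⟨m, hm, hmd⟩ : ∃ m ∈ c, m ∩ Icc (s + η) (t - η) = ∅ := by
      have : Nonempty c := hne.to_subtype
      obtain ⟨m, hm⟩ := (isCompact_Icc (a := s + η) (b := t - η)).elim_directed_family_closed
        (fun m : c => (m : Set ℝ)) (fun m => (hc m.2).1) (by
          rw [eq_empty_iff_forall_notMem]
          rintro z ⟨hz, hz'⟩
          refine hgap z (fun m hm => mem_iInter.1 hz' ⟨m, hm⟩) (by linarith [hz.1])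
            (by linarith [hz.2])) (by
          intro x y
          rcases hch.total x.2 y.2 with h | h
          · exact ⟨x, Subset.rfl, h⟩
          · exact ⟨y, h, Subset.rfl⟩)
      exact ⟨m, m.2, by rw [inter_comm]; exact hm⟩
    obtain ⟨hm1, hm2, hm3, hm4⟩ := hc hm
    obtain ⟨s', hs'⟩ := dm_sigma hm1 hm2 (s + η)
    obtain ⟨t', ht'⟩ := dm_tau hm1 hm3 (s + η)
    have a1 : s ≤ s' := hs'.2 ⟨hs m hm, by simp; linarith⟩
    have a2 : s' ≤ s + η := hs'.1.2
    have b1 : t' ≤ t := ht'.2 ⟨ht m hm, by simp; linarith⟩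
    have b2 : s + η ≤ t' := ht'.1.2
    have b3 : t - η < t' := by
      by_contra hh
      have : t' ∈ m ∩ Icc (s + η) (t - η) := ⟨ht'.1.1, b2, not_lt.1 hh⟩
      rw [hmd] at this; exact this
    have hff : f s' = f t' := by
      refine hm4 s' hs'.1.1 t' ht'.1.1 (by linarith) ?_
      intro x hx hx1 hx2
      rcases le_total x (s + η) with h | h
      · exact absurd (hs'.2 ⟨hx, h⟩) (not_le.2 hx1)
      · exact absurd (ht'.2 ⟨hx, h⟩) (not_le.2 hx2)
    have k1 := h1 s' (by rw [Real.dist_eq, abs_lt]; constructor <;> linarith)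
    have k2 := h2 t' (by rw [Real.dist_eq, abs_lt]; constructor <;> linarith)
    have k3 := dist_triangle_left (f s) (f t) (f s')
    rw [hff] at k1 k3
    linarith) univ hu
  exact ⟨M, hM⟩

theorem dm_erase {X : Type*} [MetricSpace X] (f : ℝ → X) (hf : Continuous f) {a b : X}
    (hfa : ∀ t ≤ 0, f t = a) (hfb : ∀ t ≥ 1, f t = b) :
    ∃ g : ℝ → X, Continuous g ∧ g 0 = a ∧ g 1 = b ∧ (∀ t, ∃ s, g t = f s) ∧
      ∀ s u t, 0 ≤ s → s ≤ u → u ≤ t → t ≤ 1 → g s = g t → g u = g s := by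
  obtain ⟨M, hM⟩ := dm_minimal f hf
  obtain ⟨⟨hM1, hM2, hM3, hM4⟩, hmin⟩ := hM
  have hinj : ∀ s ∈ M, ∀ t ∈ M, 0 ≤ s → t ≤ 1 → f s = f t → ∀ x ∈ M, s < x → x < t → False := by
    intro s hs t ht h0 h1 hst x hx hx1 hx2
    have hg : DMGood f (M \ Ioo s t) := by
      refine ⟨hM1.sdiff isOpen_Ioo, ?_, ?_, ?_⟩
      · exact fun y hy => ⟨hM2 hy, fun hh => absurd hh.1 (by simp at hy; linarith)⟩
      · exact fun y hy => ⟨hM3 hy, fun hh => absurd hh.2 (by simp at hy; linarith)⟩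
      · intro s1 hs1 t1 ht1 hst1 hgap
        by_cases hh : ∀ m ∈ M, s1 < m → m < t1 → False
        · exact hM4 s1 hs1.1 t1 ht1.1 hst1 hh
        · push Not at hh
          obtain ⟨m, hm, m1, m2, -⟩ := hh
          have hmI : m ∈ Ioo s t := by
            by_contra h; exact hgap m ⟨hm, h⟩ m1 m2
          have e1 : s ≤ s1 := by
            by_contra h; exact hgap s ⟨hs, by simp⟩ (not_le.1 h) (hmI.1.trans m2)
          have e2 : t1 ≤ t := by
            by_contra h; exact hgap t ⟨ht, by simp⟩ (m1.trans hmI.2) (not_le.1 h)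
          have e3 : s1 ≤ s := by
            by_contra h; exact hs1.2 ⟨not_le.1 h, m1.trans hmI.2⟩
          have e4 : t ≤ t1 := by
            by_contra h; exact ht1.2 ⟨hmI.1.trans m2, not_le.1 h⟩
          rw [le_antisymm e3 e1, le_antisymm e2 e4, hst]
    exact (hmin hg sdiff_subset hx).2 ⟨hx1, hx2⟩
  choose σ hσ using dm_sigma hM1 hM2
  have hσM : ∀ u, σ u ∈ M := fun u => (hσ u).1.1
  have hσle : ∀ u, σ u ≤ u := fun u => (hσ u).1.2
  have hσge : ∀ u, ∀ x ∈ M, x ≤ u → x ≤ σ u := fun u x hx h => (hσ u).2 ⟨hx, h⟩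
  have hτ : ∀ u m, IsLeast (M ∩ Ici u) m → f (σ u) = f m := by
    intro u m hm
    have h1 : σ u ≤ m := (hσle u).trans hm.1.2
    rcases h1.eq_or_lt with h | h
    · rw [h]
    · refine hM4 _ (hσM u) _ hm.1.1 h ?_
      intro x hx hx1 hx2
      rcases le_total x u with h | h
      · exact absurd (hσge u x hx h) (not_le.2 hx1)
      · exact absurd (hm.2 ⟨hx, h⟩) (not_le.2 hx2)
  have hσmono : ∀ u v, u ≤ v → σ u ≤ σ v := fun u v h => hσge v _ (hσM u) ((hσle u).trans h)
  have two : ∀ u v, u ≤ v → f (σ u) = f (σ v) ∨ ∃ m m', u ≤ m ∧ m ≤ v ∧ u ≤ m' ∧ m' ≤ v ∧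
      f (σ u) = f m ∧ f (σ v) = f m' := by
    intro u v huv
    obtain ⟨m, hm⟩ := dm_tau hM1 hM3 u
    by_cases h : m ≤ v
    · exact Or.inr ⟨m, σ v, hm.1.2, h, le_trans hm.1.2 (hσge v m hm.1.1 h), hσle v, hτ u m hm, rfl⟩
    · left
      have : σ v ≤ σ u := by
        apply hσge u _ (hσM v)
        by_contra hh
        exact h ((hm.2 ⟨hσM v, (not_le.1 hh).le⟩).trans (hσle v))
      rw [le_antisymm this (hσmono u v huv)]
  refine ⟨fun u => f (σ u), ?_, hfa _ (hσle 0), ?_, fun t => ⟨_, rfl⟩, ?_⟩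
  · rw [Metric.continuous_iff]
    intro v ε hε
    obtain ⟨d, hd, h⟩ := Metric.continuous_iff.1 hf v (ε / 2) (by positivity)
    refine ⟨d, hd, fun u hu => ?_⟩
    rw [Real.dist_eq, abs_lt] at hu
    have fin : ∀ m m', dist m v < d → dist m' v < d → dist (f m) (f m') < ε := by
      intro m m' h1 h2
      have := dist_triangle_right (f m) (f m') (f v)
      linarith [h m h1, h m' h2]
    rcases le_total u v with huv | huv
    · rcases two u v huv with e | ⟨m, m', a1, a2, a3, a4, a5, a6⟩
      · rw [e, dist_self]; exact hε
      · rw [a5, a6]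
        apply fin <;> rw [Real.dist_eq, abs_lt] <;> constructor <;> linarith
    · rcases two v u huv with e | ⟨m, m', a1, a2, a3, a4, a5, a6⟩
      · rw [e, dist_self]; exact hε
      · rw [a5, a6]
        apply fin <;> rw [Real.dist_eq, abs_lt] <;> constructor <;> linarith
  · have : σ 1 = 1 := le_antisymm (hσle 1) (hσge 1 1 (hM3 (by simp)) le_rfl)
    simp only [this]; exact hfb 1 le_rfl
  · intro s u t h0 h1 h2 h3 hst
    have m1 := hσmono _ _ h1
    have m2 := hσmono _ _ h2
    have hs0 : 0 ≤ σ s := hσge s 0 (hM2 (by simp)) h0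
    have ht1 : σ t ≤ 1 := (hσle t).trans h3
    rcases m1.eq_or_lt with h | h
    · simp only [h]
    rcases m2.eq_or_lt with h' | h'
    · simp only [h']; exact hst.symm
    exact (hinj _ (hσM s) _ (hσM t) hs0 ht1 hst _ (hσM u) h h').elim

theorem dm_param {X : Type*} [MetricSpace X] [CompactSpace X] (g : ℝ → X) (hg : Continuous g)
    (hne : g 0 ≠ g 1)
    (hfib : ∀ s u t, 0 ≤ s → s ≤ u → u ≤ t → t ≤ 1 → g s = g t → g u = g s) :
    ∃ (c d : ℝ) (h : ℝ → X), c < d ∧ ContinuousOn h (Icc c d) ∧ InjOn h (Icc c d) ∧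
      h c = g 1 ∧ h d = g 0 ∧ ∀ y, ∃ t, h y = g t := by
  have : Nonempty X := ⟨g 0⟩
  let x : ℕ → X := TopologicalSpace.denseSeq X
  have hx : DenseRange x := TopologicalSpace.denseRange_denseSeq X
  let ψ : ℕ → ℝ → ℝ := fun n t => sInf ((fun w : ℝ => dist (g (t * w)) (x n)) '' Icc 0 1)
  have hψc : ∀ n, Continuous (ψ n) := by
    intro n
    exact IsCompact.continuous_sInf (f := fun t w : ℝ => dist (g (t * w)) (x n)) isCompact_Icc
      (by simp only [Function.HasUncurry.uncurry]; fun_prop)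
  have hbdd : ∀ n t, BddBelow ((fun w : ℝ => dist (g (t * w)) (x n)) '' Icc 0 1) := by
    rintro n t
    exact ⟨0, by rintro _ ⟨w, -, rfl⟩; exact dist_nonneg⟩
  have hnon : ∀ n t, ((fun w : ℝ => dist (g (t * w)) (x n)) '' Icc 0 1).Nonempty :=
    fun n t => (nonempty_Icc.2 zero_le_one).image _
  have hψ0 : ∀ n t, 0 ≤ ψ n t := by
    intro n t
    refine le_csInf (hnon n t) ?_
    rintro _ ⟨w, -, rfl⟩; exact dist_nonneg
  have hψle : ∀ n t w, 0 ≤ w → w ≤ t → ψ n t ≤ dist (g w) (x n) := by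
    intro n t w h0 h1
    refine csInf_le (hbdd n t) ?_
    rcases h0.eq_or_lt with rfl | h0
    · exact ⟨0, by simp, by simp⟩
    · have ht : 0 < t := h0.trans_le h1
      refine ⟨w / t, ⟨by positivity, (div_le_one ht).2 h1⟩, ?_⟩
      simp only
      rw [mul_div_cancel₀ _ ht.ne']
  have hleψ : ∀ n t r, 0 ≤ t → (∀ w, 0 ≤ w → w ≤ t → r ≤ dist (g w) (x n)) → r ≤ ψ n t := by
    intro n t r ht h
    refine le_csInf (hnon n t) ?_
    rintro _ ⟨w, hw, rfl⟩
    exact h _ (mul_nonneg ht hw.1) (mul_le_of_le_one_right ht hw.2)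
  have hanti : ∀ n s t, 0 ≤ s → s ≤ t → ψ n t ≤ ψ n s := fun n s t h0 h1 =>
    hleψ n s _ h0 fun w hw0 hw1 => hψle n t w hw0 (hw1.trans h1)
  obtain ⟨D, hD⟩ : ∃ D, ∀ n t, ψ n t ≤ D := by
    refine ⟨Metric.diam (univ : Set X), fun n t => ?_⟩
    refine (csInf_le (hbdd n t) ⟨0, by simp, rfl⟩).trans ?_
    exact Metric.dist_le_diam_of_mem isCompact_univ.isBounded trivial trivial
  have hnorm : ∀ n t, ‖(1 / 2 : ℝ) ^ n * ψ n t‖ ≤ (1 / 2 : ℝ) ^ n * D := by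
    intro n t
    rw [Real.norm_of_nonneg (mul_nonneg (by positivity) (hψ0 n t))]
    gcongr
    exact hD n t
  have hsumD : Summable fun n : ℕ => (1 / 2 : ℝ) ^ n * D :=
    (summable_geometric_of_lt_one (by norm_num) (by norm_num)).mul_right D
  have hsum : ∀ t, Summable fun n => (1 / 2 : ℝ) ^ n * ψ n t := fun t =>
    Summable.of_norm_bounded hsumD fun n => hnorm n t
  let φ : ℝ → ℝ := fun t => ∑' n, (1 / 2 : ℝ) ^ n * ψ n t
  have hφc : Continuous φ :=
    continuous_tsum (fun n => continuous_const.mul (hψc n)) hsumD hnorm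
  have hlt : ∀ s t, 0 ≤ s → s ≤ t → t ≤ 1 → g s ≠ g t → φ t < φ s := by
    intro s t h0 h1 h2 hst
    have hK : IsClosed (g '' Icc 0 s) := (isCompact_Icc.image hg).isClosed
    have hnot : g t ∉ g '' Icc 0 s := by
      rintro ⟨u, hu, e⟩
      exact hst ((hfib u s t hu.1 hu.2 h1 h2 e).trans e)
    obtain ⟨r, hr, hrK⟩ := Metric.isOpen_iff.1 hK.isOpen_compl _ hnot
    obtain ⟨n, hn⟩ := hx.exists_dist_lt (g t) (half_pos hr)
    refine Summable.tsum_lt_tsum (i := n) (fun m => ?_) ?_ (hsum t) (hsum s)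
    · gcongr
      exact hanti m s t h0 h1
    · gcongr
      calc ψ n t ≤ dist (g t) (x n) := hψle n t t (h0.trans h1) le_rfl
        _ < r / 2 := hn
        _ ≤ ψ n s := by
          refine hleψ n s _ h0 fun w hw0 hw1 => ?_
          by_contra hh
          have : g w ∈ Metric.ball (g t) r := by
            have := dist_triangle_right (g w) (g t) (x n)
            rw [Metric.mem_ball]; linarith
          exact hrK this ⟨w, ⟨hw0, hw1⟩, rfl⟩
  have heq : ∀ s t, 0 ≤ s → s ≤ t → t ≤ 1 → g s = g t → φ s = φ t := by
    intro s t h0 h1 h2 hst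
    have : ∀ n, ψ n s = ψ n t := by
      intro n
      refine le_antisymm ?_ (hanti n s t h0 h1)
      refine hleψ n t _ (h0.trans h1) fun w hw0 hw1 => ?_
      rcases le_total w s with h | h
      · exact hψle n s w hw0 h
      · rw [hfib s w t h0 h hw1 h2 hst]
        exact hψle n s s h0 le_rfl
    simp only [φ, this]
  have hiff : ∀ s ∈ Icc (0 : ℝ) 1, ∀ t ∈ Icc (0 : ℝ) 1, φ s = φ t ↔ g s = g t := by
    intro s hs t ht
    rcases le_total s t with h | h
    · refine ⟨fun e => ?_, heq s t hs.1 h ht.2⟩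
      by_contra hh; exact (hlt s t hs.1 h ht.2 hh).ne' e
    · refine ⟨fun e => ?_, fun e => (heq t s ht.1 h hs.2 e.symm).symm⟩
      by_contra hh; exact (hlt t s ht.1 h hs.2 (Ne.symm hh)).ne e
  have hsurj : ∀ y, ∃ t, y ∈ Icc (φ 1) (φ 0) → t ∈ Icc (0 : ℝ) 1 ∧ φ t = y := by
    intro y
    by_cases hy : y ∈ Icc (φ 1) (φ 0)
    · obtain ⟨t, ht, e⟩ := intermediate_value_Icc' zero_le_one hφc.continuousOn hy
      exact ⟨t, fun _ => ⟨ht, e⟩⟩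
    · exact ⟨0, fun h => absurd h hy⟩
  choose T hT using hsurj
  have hcd : φ 1 < φ 0 := hlt 0 1 le_rfl zero_le_one le_rfl hne
  have hTφ : ∀ t ∈ Icc (0 : ℝ) 1, φ t ∈ Icc (φ 1) (φ 0) → g (T (φ t)) = g t := fun t ht h =>
    (hiff _ (hT _ h).1 _ ht).1 (hT _ h).2
  refine ⟨φ 1, φ 0, fun y => g (T y), hcd, ?_, ?_, hTφ 1 (by simp) ⟨le_rfl, hcd.le⟩,
    hTφ 0 (by simp) ⟨hcd.le, le_rfl⟩, fun y => ⟨_, rfl⟩⟩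
  · rw [continuousOn_iff_isClosed]
    intro F hF
    refine ⟨φ '' (Icc 0 1 ∩ g ⁻¹' F),
      ((isCompact_Icc.inter_right (hF.preimage hg)).image hφc).isClosed, ?_⟩
    ext y
    constructor
    · rintro ⟨h1, h2⟩
      exact ⟨⟨T y, ⟨(hT y h2).1, h1⟩, (hT y h2).2⟩, h2⟩
    · rintro ⟨⟨t, ⟨ht, hF'⟩, rfl⟩, h2⟩
      refine ⟨?_, h2⟩
      simp only [mem_preimage]
      rw [hTφ t ht h2]; exact hF'
  · intro y hy y' hy' e
    have := (hiff _ (hT y hy).1 _ (hT y' hy').1).2 e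
    rwa [(hT y hy).2, (hT y' hy').2] at this

theorem dm_arc {X : Type*} [MetricSpace X] [CompactSpace X] [LocallyConnectedSpace X] {U : Set X}
    (hU : IsOpen U) (hc : IsPreconnected U) {a b : X} (ha : a ∈ U) (hb : b ∈ U) (hab : a ≠ b) :
    ∃ (c d : ℝ) (h : ℝ → X), c < d ∧ ContinuousOn h (Icc c d) ∧ InjOn h (Icc c d) ∧
      h c = a ∧ h d = b ∧ ∀ y, h y ∈ U := by
  obtain ⟨f, hf, h0, h1, hfU⟩ := dm_path hU hc hb ha
  obtain ⟨g, hg, g0, g1, hgf, hfib⟩ := dm_erase f hf h0 h1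
  obtain ⟨c, d, h, hcd, k1, k2, k3, k4, k5⟩ := dm_param g hg (by rw [g0, g1]; exact hab.symm) hfib
  refine ⟨c, d, h, hcd, k1, k2, k3.trans g1, k4.trans g0, fun y => ?_⟩
  obtain ⟨t, ht⟩ := k5 y
  obtain ⟨s, hs⟩ := hgf t
  rw [ht, hs]; exact hfU s

theorem dm_circle {X : Type*} [TopologicalSpace X] [T2Space X] (c : ℝ → X)
    (hc : ContinuousOn c (Icc 0 1)) (h01 : c 0 = c 1) (hi : InjOn c (Ico 0 1)) :
    ∃ S : Set X, Nonempty (S ≃ₜ Circle) := by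
  have : Fact ((0 : ℝ) < 1) := ⟨one_pos⟩
  have hcont : Continuous (AddCircle.liftIco 1 0 c) :=
    AddCircle.liftIco_continuous (by simpa using h01) (by simpa using hc)
  have hinj : Function.Injective (AddCircle.liftIco 1 0 c) := by
    refine Function.Injective.comp ?_ (AddCircle.equivIco 1 0).injective
    rintro ⟨x, hx⟩ ⟨y, hy⟩ e
    exact Subtype.ext (hi (by simpa using hx) (by simpa using hy) e)
  have hemb := (hcont.isClosedEmbedding hinj).isEmbedding
  exact ⟨_, ⟨hemb.toHomeomorph.symm.trans (AddCircle.homeomorphCircle one_ne_zero)⟩⟩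

theorem dm_join {X : Type*} [TopologicalSpace X] [T2Space X] (α β : ℝ → X) {r s u v : ℝ}
    (hrs : r < s) (huv : u ≠ v)
    (hα : ContinuousOn α (Icc r s)) (hαi : InjOn α (Icc r s))
    (hβ : ContinuousOn β (uIcc u v)) (hβi : InjOn β (uIcc u v))
    (hr : α r = β u) (hs : α s = β v)
    (hd : ∀ x ∈ Ioo r s, ∀ y ∈ uIcc u v, α x ≠ β y) :
    ∃ S : Set X, Nonempty (S ≃ₜ Circle) := by
  let A : ℝ → ℝ := fun t => r + 2 * t * (s - r)
  let B : ℝ → ℝ := fun t => v + (2 * t - 1) * (u - v)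
  have hA : ∀ t, 0 ≤ t → t ≤ 1 / 2 → A t ∈ Icc r s := by
    intro t h0 h1
    constructor <;> simp only [A] <;> nlinarith
  have hB : ∀ t, 1 / 2 ≤ t → t ≤ 1 → B t ∈ uIcc u v := by
    intro t h0 h1
    rw [mem_uIcc]
    rcases huv.lt_or_gt with h | h
    · left; constructor <;> simp only [B] <;> nlinarith
    · right; constructor <;> simp only [B] <;> nlinarith
  have hA' : ∀ t, 0 < t → t < 1 / 2 → A t ∈ Ioo r s := by
    intro t h0 h1
    constructor <;> simp only [A] <;> nlinarith
  have hAi : ∀ x y, A x = A y → x = y := by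
    intro x y h
    have h1 : (s - r) * (x - y) = 0 := by simp only [A] at h; linarith
    rcases mul_eq_zero.1 h1 with h2 | h2 <;> linarith
  have hBi : ∀ x y, B x = B y → x = y := by
    intro x y h
    have h1 : (u - v) * (x - y) = 0 := by simp only [B] at h; linarith
    rcases mul_eq_zero.1 h1 with h2 | h2
    · exact absurd (sub_eq_zero.1 h2) huv
    · linarith
  have cross : ∀ x y, 0 ≤ x → x ≤ 1 / 2 → 1 / 2 < y → y < 1 → α (A x) ≠ β (B y) := by
    intro x y hx0 hx1 hy0 hy1 e
    have hyB := hB y hy0.le hy1.le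
    rcases hx0.eq_or_lt with h | h
    · have hAx : A x = r := by simp [A, ← h]
      have hB1 : B 1 = u := by simp only [B]; ring
      rw [hAx, hr] at e
      have := hβi left_mem_uIcc hyB e
      rw [← hB1] at this
      linarith [hBi _ _ this]
    rcases hx1.eq_or_lt with h' | h'
    · have hAx : A x = s := by simp only [A, h']; ring
      have hB1 : B (1 / 2) = v := by simp only [B]; ring
      rw [hAx, hs] at e
      have := hβi right_mem_uIcc hyB e
      rw [← hB1] at this
      linarith [hBi _ _ this]
    exact hd _ (hA' x h h') _ hyB e
  refine dm_circle (fun t => if t ≤ 1 / 2 then α (A t) else β (B t)) ?_ ?_ ?_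
  · have e : Icc (0 : ℝ) 1 = Icc 0 (1 / 2) ∪ Icc (1 / 2) 1 := by
      rw [Icc_union_Icc_eq_Icc] <;> norm_num
    rw [e]
    refine ContinuousOn.union_of_isClosed ?_ ?_ isClosed_Icc isClosed_Icc
    · refine ContinuousOn.congr (f := fun t => α (A t)) ?_ ?_
      · exact hα.comp (by fun_prop) fun t ht => hA t ht.1 ht.2
      · intro t ht
        simp only [if_pos ht.2]
    · refine ContinuousOn.congr (f := fun t => β (B t)) ?_ ?_
      · exact hβ.comp (by fun_prop) fun t ht => hB t ht.1 ht.2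
      · intro t ht
        rcases ht.1.eq_or_lt with h | h
        · subst h
          simp only [le_refl, if_true]
          have h1 : A (1 / 2) = s := by simp only [A]; ring
          have h2 : B (1 / 2) = v := by simp only [B]; ring
          rw [h1, h2, hs]
        · simp only [if_neg (not_le.2 h)]
  · have h1 : A 0 = r := by simp only [A]; ring
    have h2 : B 1 = u := by simp only [B]; ring
    have h3 : ¬ ((1 : ℝ) ≤ 1 / 2) := by norm_num
    have h4 : ((0 : ℝ) ≤ 1 / 2) := by norm_num
    simp only [if_pos h4, if_neg h3, h1, h2, hr]
  · intro x hx y hy e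
    simp only at e
    split_ifs at e with h1 h2 h2
    · exact hAi _ _ (hαi (hA x hx.1 h1) (hA y hy.1 h2) e)
    · exact (cross x y hx.1 h1 (not_le.1 h2) hy.2 e).elim
    · exact (cross y x hy.1 h2 (not_le.1 h1) hx.2 e.symm).elim
    · exact hBi _ _ (hβi (hB x (not_le.1 h1).le hx.2.le) (hB y (not_le.1 h2).le hy.2.le) e)

/-- Without simple closed curves, a closed connected set through the end points of an arc contains
the arc. -/
theorem dm_arc_sub {X : Type*} [MetricSpace X] [CompactSpace X] [LocallyConnectedSpace X]
    (hno : ¬ ∃ S : Set X, Nonempty (S ≃ₜ Circle)) {c d : ℝ} {α : ℝ → X} (hcd : c < d)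
    (hα : ContinuousOn α (Icc c d)) (hαi : InjOn α (Icc c d)) {K : Set X} (hK : IsPreconnected K)
    (hcK : α c ∈ K) (hdK : α d ∈ K) : α '' Icc c d ⊆ K := by
  rintro _ ⟨t, ht, rfl⟩
  by_contra hz
  apply hno
  set z := α t with hzdef
  have hsub : K ⊆ {z}ᶜ := fun y hy h => hz (by rw [← mem_singleton_iff.1 h]; exact hy)
  have hKU : K ⊆ connectedComponentIn {z}ᶜ (α c) := hK.subset_connectedComponentIn hcK hsub
  have hne : α c ≠ α d := fun e => hcd.ne (hαi ⟨le_rfl, hcd.le⟩ ⟨hcd.le, le_rfl⟩ e)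
  obtain ⟨c', d', β, hcd', hβ, hβi, hβc, hβd, hβU⟩ :=
    dm_arc (isOpen_compl_singleton.connectedComponentIn) isPreconnected_connectedComponentIn
      (hKU hcK) (hKU hdK) hne
  have hβz : ∀ y, β y ≠ z := fun y => connectedComponentIn_subset _ _ (hβU y)
  have hBc : IsClosed (β '' Icc c' d') := (isCompact_Icc.image_of_continuousOn hβ).isClosed
  have hP : IsClosed (Icc c d ∩ α ⁻¹' (β '' Icc c' d')) := hα.preimage_isClosed_of_isClosed isClosed_Icc hBc
  set P := Icc c d ∩ α ⁻¹' (β '' Icc c' d') with hPdef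
  have hcP : c ∈ P := ⟨⟨le_rfl, hcd.le⟩, c', ⟨le_rfl, hcd'.le⟩, hβc⟩
  have hdP : d ∈ P := ⟨⟨hcd.le, le_rfl⟩, d', ⟨hcd'.le, le_rfl⟩, hβd⟩
  have htP : t ∉ P := by
    rintro ⟨-, y, -, hy⟩
    exact hβz y hy
  obtain ⟨r, hr⟩ : ∃ r, IsGreatest (P ∩ Iic t) r :=
    ⟨_, IsClosed.isGreatest_csSup (hP.inter isClosed_Iic) ⟨c, hcP, ht.1⟩ ⟨t, fun x hx => hx.2⟩⟩
  obtain ⟨s, hs⟩ : ∃ s, IsLeast (P ∩ Ici t) s :=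
    ⟨_, IsClosed.isLeast_csInf (hP.inter isClosed_Ici) ⟨d, hdP, ht.2⟩ ⟨t, fun x hx => hx.2⟩⟩
  have hrt : r < t := lt_of_le_of_ne hr.1.2 fun e => htP (e ▸ hr.1.1)
  have hts : t < s := lt_of_le_of_ne hs.1.2 fun e => htP (e ▸ hs.1.1)
  obtain ⟨⟨hrI, u, hu, hru⟩, -⟩ := hr.1
  obtain ⟨⟨hsI, v, hv, hsv⟩, -⟩ := hs.1
  have hsubI : Icc r s ⊆ Icc c d := Icc_subset_Icc hrI.1 hsI.2
  have hsubJ : uIcc u v ⊆ Icc c' d' := uIcc_subset_Icc hu hv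
  refine dm_join α β (hrt.trans hts) (u := u) (v := v) ?_ (hα.mono hsubI) (hαi.mono hsubI)
    (hβ.mono hsubJ) (hβi.mono hsubJ) hru.symm hsv.symm ?_
  · rintro rfl
    exact (hrt.trans hts).ne (hαi hrI hsI (hru.symm.trans hsv))
  · intro x hx y hy e
    have hxP : x ∈ P := ⟨hsubI ⟨hx.1.le, hx.2.le⟩, y, hsubJ hy, e.symm⟩
    rcases le_total x t with h | h
    · exact absurd (hr.2 ⟨hxP, h⟩) (not_le.2 hx.1)
    · exact absurd (hs.2 ⟨hxP, h⟩) (not_le.2 hx.2)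

/-- In an open connected set, a compact subset lies in a closed connected subset. -/
theorem dm_avoid {X : Type*} [MetricSpace X] [CompactSpace X] [LocallyConnectedSpace X]
    {U C : Set X} (hU : IsOpen U) (hc : IsPreconnected U) {x : X} (hx : x ∈ U) (hC : IsClosed C)
    (hCU : C ⊆ U) : ∃ K, IsClosed K ∧ IsPreconnected K ∧ K ⊆ U ∧ C ⊆ K := by
  have : ∃ K, IsClosed K ∧ IsPreconnected K ∧ K ⊆ U ∧ x ∈ K ∧ C ⊆ K := by
    refine hC.isCompact.induction_on
      (p := fun C => ∃ K, IsClosed K ∧ IsPreconnected K ∧ K ⊆ U ∧ x ∈ K ∧ C ⊆ K) ?_ ?_ ?_ ?_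
    · exact ⟨{x}, isClosed_singleton, isPreconnected_singleton, by simpa using hx, rfl,
        empty_subset _⟩
    · rintro s t hst ⟨K, h1, h2, h3, h4, h5⟩
      exact ⟨K, h1, h2, h3, h4, hst.trans h5⟩
    · rintro s t ⟨K, h1, h2, h3, h4, h5⟩ ⟨L, k1, k2, k3, k4, k5⟩
      exact ⟨K ∪ L, h1.union k1, h2.union x h4 k4 k2, union_subset h3 k3, Or.inl h4,
        union_subset_union h5 k5⟩
    · intro y hy
      obtain ⟨V, v1, v2, v3, v4, -⟩ := dm_small hU (hCU hy) one_pos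
      obtain ⟨f, hf, f0, f1, hfU⟩ := dm_path hU hc hx (hCU hy)
      refine ⟨V, mem_nhdsWithin_of_mem_nhds (v1.mem_nhds v3), f '' Icc 0 1 ∪ closure V,
        (isCompact_Icc.image hf).isClosed.union isClosed_closure,
        (isPreconnected_Icc.image f hf.continuousOn).union y ?_ (subset_closure v3) v2.closure,
        union_subset ?_ v4, Or.inl ⟨0, by simp, f0 0 le_rfl⟩,
        subset_closure.trans subset_union_right⟩
      · exact ⟨1, by simp, f1 1 le_rfl⟩
      · rintro _ ⟨t, -, rfl⟩; exact hfU t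
  obtain ⟨K, h1, h2, h3, -, h5⟩ := this
  exact ⟨K, h1, h2, h3, h5⟩

theorem dendroMinimal_orbit_closure_contains_ends (G X : Type*) [Group G]
    [TopologicalSpace X] [MulAction G X]
    (hcont : ∀ g : G, Continuous fun x : X => g • x)
    (hX : IsDendrite X) (hmin : DendroMinimal G X) :
    ∀ x e : X, IsConnected ({e}ᶜ : Set X) →
      e ∈ closure (Set.range fun g : G => g • x) := by
  intro x e he
  obtain ⟨-, hcomp, hconn, hmet, hloc, hno⟩ := hX
  letI : MetricSpace X := TopologicalSpace.metrizableSpaceMetric X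
  by_contra heC
  set C := closure (Set.range fun g : G => g • x) with hC
  have hxC : x ∈ C := subset_closure ⟨1, one_smul _ _⟩
  have hCinv : ∀ g : G, ∀ y ∈ C, g • y ∈ C := by
    intro g y hy
    refine map_mem_closure (hcont g) hy ?_
    rintro _ ⟨h, rfl⟩
    exact ⟨g * h, mul_smul _ _ _⟩
  have hCe : C ⊆ {e}ᶜ := fun y hy h => heC (by rw [← mem_singleton_iff.1 h]; exact hy)
  let Y : Set X := ⋂₀ {K | IsClosed K ∧ IsPreconnected K ∧ C ⊆ K}
  have hYinv : ∀ g : G, ∀ y ∈ Y, g • y ∈ Y := by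
    rintro g y hy K ⟨h1, h2, h3⟩
    have : y ∈ (fun z : X => g • z) ⁻¹' K := by
      refine hy _ ⟨h1.preimage (hcont g), ?_, fun z hz => h3 (hCinv g z hz)⟩
      have e : (fun z : X => g • z) ⁻¹' K = (fun z : X => g⁻¹ • z) '' K := by
        ext z
        constructor
        · intro hz; exact ⟨g • z, hz, inv_smul_smul g z⟩
        · rintro ⟨w, hw, rfl⟩
          simpa using hw
      rw [e]
      exact h2.image _ (hcont g⁻¹).continuousOn
    exact this
  have hY : Y = univ := by
    refine hmin Y ⟨x, fun K hK => hK.2.2 hxC⟩ (isClosed_sInter fun K hK => hK.1) ?_ ?_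
    · refine isPreconnected_of_forall_pair fun p hp q hq => ?_
      rcases eq_or_ne p q with rfl | hpq
      · exact ⟨{p}, by simpa using hp, rfl, rfl, isPreconnected_singleton⟩
      obtain ⟨c, d, α, hcd, hα, hαi, hαc, hαd, -⟩ :=
        dm_arc isOpen_univ isPreconnected_univ (mem_univ p) (mem_univ q) hpq
      refine ⟨α '' Icc c d, ?_, ⟨c, ⟨le_rfl, hcd.le⟩, hαc⟩, ⟨d, ⟨hcd.le, le_rfl⟩, hαd⟩,
        isPreconnected_Icc.image α hα⟩
      intro y hy K hK
      exact dm_arc_sub hno hcd hα hαi hK.2.1 (by rw [hαc]; exact hp K hK)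
        (by rw [hαd]; exact hq K hK) hy
    · intro g
      apply Subset.antisymm
      · rintro _ ⟨y, hy, rfl⟩; exact hYinv g y hy
      · intro y hy
        exact ⟨g⁻¹ • y, hYinv _ y hy, smul_inv_smul g y⟩
  obtain ⟨K, k1, k2, k3, k4⟩ :=
    dm_avoid isOpen_compl_singleton he.isPreconnected (hCe hxC) isClosed_closure hCe
  have : e ∈ Y := hY ▸ mem_univ e
  exact k3 (this K ⟨k1, k2, k4⟩) rfl
end
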